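/- If M is a preprojective k(Γ,Λ)-module, then the word w(S_M) in the Weyl group W is reduced. -/

import Mathlib

namespace KP

/-! ## Quivers on a fixed vertex set `Fin n`.

An orientation is encoded by `Λ : Fin n → Fin n → ℕ`, where `Λ a b` is the number of
arrows from `a` to `b`.  The underlying graph is recorded by `edges Λ a b = Λ a b + Λ b a`. -/

/-- The orientation `σ_x Λ` obtained by reversing every arrow incident with `x`. -/
def flipO {n : ℕ} (x : Fin n) (Λ : Fin n → Fin n → ℕ) : Fin n → Fin n → ℕ :=
  fun a b => if a = x ∨ b = x then Λ b a else Λ a b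

/-- Number of edges of the underlying graph joining `a` and `b`. -/
def edges {n : ℕ} (Λ : Fin n → Fin n → ℕ) (a b : Fin n) : ℕ := Λ a b + Λ b a

/-- `x` is a sink: no arrow starts at `x`. -/
def IsSink {n : ℕ} (Λ : Fin n → Fin n → ℕ) (x : Fin n) : Prop := ∀ y, Λ x y = 0

/-- `S` is a `(+)`-admissible sequence of vertices on `(Γ, Λ)`. -/
def Admissible {n : ℕ} (Λ : Fin n → Fin n → ℕ) : List (Fin n) → Prop
  | [] => True
  | x :: xs => IsSink Λ x ∧ Admissible (flipO x Λ) xs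

/-- The orientation `Λ^S`. -/
def orientAfter {n : ℕ} (Λ : Fin n → Fin n → ℕ) : List (Fin n) → (Fin n → Fin n → ℕ)
  | [] => Λ
  | x :: xs => orientAfter (flipO x Λ) xs

/-- Elementary move: interchange two consecutive vertices not joined by an edge. -/
inductive SwapRel {n : ℕ} (E : Fin n → Fin n → ℕ) : List (Fin n) → List (Fin n) → Prop
  | swap (l₁ l₂ : List (Fin n)) (a b : Fin n) (h : E a b = 0) :
      SwapRel E (l₁ ++ a :: b :: l₂) (l₁ ++ b :: a :: l₂)

/-- The equivalence `∼` on sequences of vertices: reflexive–transitive closure of the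
(symmetric) relation `SwapRel`. -/
def Sim {n : ℕ} (E : Fin n → Fin n → ℕ) : List (Fin n) → List (Fin n) → Prop :=
  Relation.ReflTransGen (SwapRel E)

/-- The preorder `S ⪯ T` : `T ∼ S ++ U` for some `(+)`-admissible sequence `U` on `(Γ, Λ^S)`. -/
def Preceq {n : ℕ} (Λ : Fin n → Fin n → ℕ) (S T : List (Fin n)) : Prop :=
  ∃ U, Admissible (orientAfter Λ S) U ∧ Sim (edges Λ) T (S ++ U)

/-- Support of a sequence of vertices. -/
def suppOf {n : ℕ} (S : List (Fin n)) : Set (Fin n) := {v | v ∈ S}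

/-- The partial order on vertices: `x ≤ y` iff there is a path from `x` to `y` in `(Γ, Λ)`. -/
def PathLE {n : ℕ} (Λ : Fin n → Fin n → ℕ) (x y : Fin n) : Prop :=
  Relation.ReflTransGen (fun a b => Λ a b ≠ 0) x y

/-- A filter (up-closed set) of the poset `(Γ₀, Λ)`. -/
def IsFilter {n : ℕ} (Λ : Fin n → Fin n → ℕ) (F : Set (Fin n)) : Prop :=
  ∀ x ∈ F, ∀ y, PathLE Λ x y → y ∈ F

/-- The principal filter `⟨x⟩`. -/
def upSet {n : ℕ} (Λ : Fin n → Fin n → ℕ) (x : Fin n) : Set (Fin n) := {y | PathLE Λ x y}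

/-- The hull `H_Λ(F)`: the smallest filter containing `F` and every vertex joined
by an edge to a vertex of `F`. -/
def hull {n : ℕ} (Λ : Fin n → Fin n → ℕ) (F : Set (Fin n)) : Set (Fin n) :=
  {y | ∃ x, (x ∈ F ∨ ∃ z ∈ F, edges Λ z x ≠ 0) ∧ PathLE Λ x y}

/-- `segs` is a canonical form of `S` (Proposition 2.1): `S ∼ S₁S₂⋯S_r`, each segment
consists of distinct vertices, is nonempty, and `Supp S_i = Supp (S_i S_{i+1} ⋯ S_r)`. -/
def Segments {n : ℕ} (Λ : Fin n → Fin n → ℕ) (S : List (Fin n))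
    (segs : List (List (Fin n))) : Prop :=
  Admissible Λ segs.flatten ∧ Sim (edges Λ) S segs.flatten ∧
  (∀ seg ∈ segs, seg ≠ [] ∧ seg.Nodup) ∧
  ∀ i, i < segs.length → suppOf (segs.getD i []) = suppOf ((segs.drop i).flatten)

/-- `J` is (a representative of) the join `S ∨ T` (Definition 2.4):  the canonical form of `J`
has `Supp R_i = Supp S_i ∪ Supp T_i` (out-of-range segments read as `∅`). -/
def IsJoin {n : ℕ} (Λ : Fin n → Fin n → ℕ) (S T J : List (Fin n)) : Prop :=
  ∃ CS CT CJ, Segments Λ S CS ∧ Segments Λ T CT ∧ Segments Λ J CJ ∧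
    ∀ i, suppOf (CJ.getD i []) = suppOf (CS.getD i []) ∪ suppOf (CT.getD i [])

/-- `M` is (a representative of) the meet `S ∧ T` (Definition 2.4). -/
def IsMeet {n : ℕ} (Λ : Fin n → Fin n → ℕ) (S T M : List (Fin n)) : Prop :=
  ∃ CS CT CM, Segments Λ S CS ∧ Segments Λ T CT ∧ Segments Λ M CM ∧
    ∀ i, suppOf (CM.getD i []) = suppOf (CS.getD i []) ∩ suppOf (CT.getD i [])

/-- `S` is (equivalent to) the join `T₁ ∨ ⋯ ∨ T_l` of the list of sequences `Ts`. -/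
def IsJoinList {n : ℕ} (Λ : Fin n → Fin n → ℕ) : List (List (Fin n)) → List (Fin n) → Prop
  | [], S => S = []
  | T :: Ts, S => ∃ J, IsJoinList Λ Ts J ∧ IsJoin Λ T J S

/-- The segments of a canonical form of a principal sequence `S_{r,x}` (Definition 3.1). -/
def PrincipalSegs {n : ℕ} (Λ : Fin n → Fin n → ℕ) (segs : List (List (Fin n)))
    (r : ℕ) (x : Fin n) : Prop :=
  segs.length = r ∧ 0 < r ∧
  (∀ i, i + 1 < r → suppOf (segs.getD i []) = hull Λ (suppOf (segs.getD (i+1) []))) ∧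
  suppOf (segs.getD (r-1) []) = upSet Λ x

/-- `S ∼ S_{r,x}`, the principal `(+)`-admissible sequence of size `r` with
`Supp S_r = ⟨x⟩`. -/
def IsPrincipalSeq {n : ℕ} (Λ : Fin n → Fin n → ℕ) (r : ℕ) (x : Fin n)
    (S : List (Fin n)) : Prop :=
  ∃ segs, Segments Λ S segs ∧ PrincipalSegs Λ segs r x

/-- `S` is a principal `(+)`-admissible sequence. -/
def IsPrincipal {n : ℕ} (Λ : Fin n → Fin n → ℕ) (S : List (Fin n)) : Prop :=
  ∃ r x, IsPrincipalSeq Λ r x S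


/-! ## Representations of `(Γ, Λ)` over a field `k`. -/

/-- A (finite-dimensional) representation of the quiver `(Γ, Λ)` over `k`:
the space at vertex `x` is `Fin (d x) → k`, and each arrow carries a linear map. -/
structure Rep (k : Type) [Field k] (n : ℕ) (Λ : Fin n → Fin n → ℕ) where
  d : Fin n → ℕ
  f : ∀ a b : Fin n, Fin (Λ a b) → ((Fin (d a) → k) →ₗ[k] (Fin (d b) → k))

variable {k : Type} [Field k] {n : ℕ}

/-- A morphism of representations. -/
structure RepHom {Λ : Fin n → Fin n → ℕ} (M N : Rep k n Λ) where
  g : ∀ x, (Fin (M.d x) → k) →ₗ[k] (Fin (N.d x) → k)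
  comm : ∀ a b i v, g b (M.f a b i v) = N.f a b i (g a v)

/-- Isomorphism of representations. -/
def RepIso {Λ : Fin n → Fin n → ℕ} (M N : Rep k n Λ) : Prop :=
  ∃ g : ∀ x, (Fin (M.d x) → k) ≃ₗ[k] (Fin (N.d x) → k),
    ∀ a b i v, g b (M.f a b i v) = N.f a b i (g a v)

/-- The zero representation. -/
def IsZeroRep {Λ : Fin n → Fin n → ℕ} (M : Rep k n Λ) : Prop := ∀ x, M.d x = 0

/-- Cast between the standard spaces. -/
def castL (k : Type) [Field k] {m m' : ℕ} (h : m = m') : (Fin m → k) ≃ₗ[k] (Fin m' → k) :=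
  LinearEquiv.funCongrLeft k k (finCongr h.symm)

/-- The splitting `(Fin (m + p) → k) ≃ₗ (Fin m → k) × (Fin p → k)`. -/
def splitL (k : Type) [Field k] (m p : ℕ) : (Fin (m + p) → k) ≃ₗ[k] (Fin m → k) × (Fin p → k) :=
  (LinearEquiv.funCongrLeft k k finSumFinEquiv).trans
    (LinearEquiv.sumArrowLequivProdArrow _ _ k k)

/-- Direct sum of two representations. -/
def dSum {Λ : Fin n → Fin n → ℕ} (M N : Rep k n Λ) : Rep k n Λ where
  d x := M.d x + N.d x
  f a b i :=
    (splitL k (M.d b) (N.d b)).symm.toLinearMap ∘ₗ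
      (LinearMap.prodMap (M.f a b i) (N.f a b i)) ∘ₗ (splitL k (M.d a) (N.d a)).toLinearMap

/-- The zero representation (as an object). -/
def zeroRep (k : Type) [Field k] (n : ℕ) (Λ : Fin n → Fin n → ℕ) : Rep k n Λ where
  d _ := 0
  f _ _ _ := 0

/-- Direct sum of a list of representations. -/
def dSumList {Λ : Fin n → Fin n → ℕ} (L : List (Rep k n Λ)) : Rep k n Λ :=
  L.foldr dSum (zeroRep k n Λ)

/-- `M` is indecomposable. -/
def Indecomp {Λ : Fin n → Fin n → ℕ} (M : Rep k n Λ) : Prop :=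
  ¬ IsZeroRep M ∧ ∀ A B : Rep k n Λ, RepIso M (dSum A B) → IsZeroRep A ∨ IsZeroRep B

/-- `X` is a direct summand of `M`. -/
def IsSummand {Λ : Fin n → Fin n → ℕ} (X M : Rep k n Λ) : Prop :=
  ∃ Y, RepIso M (dSum X Y)

/-! ### Reflection functors (on objects) -/

/-- Index type of the arrows ending at `x`. -/
abbrev Arin {n : ℕ} (Λ : Fin n → Fin n → ℕ) (x : Fin n) := Σ y : Fin n, Fin (Λ y x)

/-- Index type of the arrows starting at `x`. -/
abbrev Aout {n : ℕ} (Λ : Fin n → Fin n → ℕ) (x : Fin n) := Σ y : Fin n, Fin (Λ x y)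

/-- The map `h : ⊕_{a : y → x} V(y) → V(x)` induced by the maps along the arrows ending at `x`. -/
noncomputable def inMap (Λ : Fin n → Fin n → ℕ) (M : Rep k n Λ) (x : Fin n) :
    ((p : Arin Λ x) → (Fin (M.d p.1) → k)) →ₗ[k] (Fin (M.d x) → k) :=
  ∑ p : Arin Λ x, (M.f p.1 x p.2) ∘ₗ LinearMap.proj p

/-- The map `h' : V(x) → ⊕_{a : x → y} V(y)` induced by the maps along arrows starting at `x`. -/
def outMap (Λ : Fin n → Fin n → ℕ) (M : Rep k n Λ) (x : Fin n) :
    (Fin (M.d x) → k) →ₗ[k] ((p : Aout Λ x) → (Fin (M.d p.1) → k)) :=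
  LinearMap.pi fun p => M.f x p.1 p.2

noncomputable def kerEquiv (Λ : Fin n → Fin n → ℕ) (M : Rep k n Λ) (x : Fin n) :
    LinearMap.ker (inMap Λ M x) ≃ₗ[k]
      (Fin (Module.finrank k (LinearMap.ker (inMap Λ M x))) → k) :=
  (Module.finBasis k _).equivFun

noncomputable def cokerEquiv (Λ : Fin n → Fin n → ℕ) (M : Rep k n Λ) (x : Fin n) :
    (((p : Aout Λ x) → (Fin (M.d p.1) → k)) ⧸ LinearMap.range (outMap Λ M x)) ≃ₗ[k]
      (Fin (Module.finrank k (((p : Aout Λ x) → (Fin (M.d p.1) → k)) ⧸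
        LinearMap.range (outMap Λ M x))) → k) :=
  (Module.finBasis k _).equivFun

/-- The positive reflection functor `F_x⁺` (on objects): the space at `x` is replaced
by the kernel of `inMap`, with the maps along the reversed arrows induced by inclusion
followed by the projections. -/
noncomputable def reflPlus (x : Fin n) (Λ : Fin n → Fin n → ℕ) (M : Rep k n Λ) :
    Rep k n (flipO x Λ) where
  d z := if z = x then Module.finrank k (LinearMap.ker (inMap Λ M x)) else M.d z
  f a b i :=
    if ha : a = x then
      if hb : b = x then 0
      else
        (castL k (if_neg hb).symm).toLinearMap ∘ₗ
          (LinearMap.proj (φ := fun p : Arin Λ x => Fin (M.d p.1) → k)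
            (⟨b, Fin.cast (by subst ha; simp [flipO]) i⟩ : Arin Λ x)) ∘ₗ
          (LinearMap.ker (inMap Λ M x)).subtype ∘ₗ
          (kerEquiv Λ M x).symm.toLinearMap ∘ₗ (castL k (if_pos ha)).toLinearMap
    else
      if hb : b = x then 0
      else
        (castL k (if_neg hb).symm).toLinearMap ∘ₗ
          M.f a b (Fin.cast (by simp [flipO, ha, hb]) i) ∘ₗ
          (castL k (if_neg ha)).toLinearMap

/-- The negative reflection functor `F_x⁻` (on objects), presented as a map from
representations of `(Γ, σ_x Λ)` to representations of `(Γ, Λ)`: the space at `x` is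
replaced by the cokernel of `outMap`. -/
noncomputable def reflMinus (x : Fin n) (Λ : Fin n → Fin n → ℕ)
    (N : Rep k n (flipO x Λ)) : Rep k n Λ where
  d z := if z = x then
      Module.finrank k (((p : Aout (flipO x Λ) x) → (Fin (N.d p.1) → k)) ⧸
        LinearMap.range (outMap (flipO x Λ) N x))
    else N.d z
  f a b i :=
    if hb : b = x then
      if ha : a = x then 0
      else
        (castL k (if_pos hb).symm).toLinearMap ∘ₗ
          (cokerEquiv (flipO x Λ) N x).toLinearMap ∘ₗ
          (LinearMap.range (outMap (flipO x Λ) N x)).mkQ ∘ₗ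
          (LinearMap.single k (fun p : Aout (flipO x Λ) x => Fin (N.d p.1) → k)
            (⟨a, Fin.cast (by subst hb; simp [flipO]) i⟩ : Aout (flipO x Λ) x)) ∘ₗ
          (castL k (if_neg ha)).toLinearMap
    else
      if ha : a = x then 0
      else
        (castL k (if_neg hb).symm).toLinearMap ∘ₗ
          N.f a b (Fin.cast (by simp [flipO, ha, hb]) i) ∘ₗ
          (castL k (if_neg ha)).toLinearMap

/-- `F(S) = F_{x_s}⁺ ⋯ F_{x_1}⁺` applied to a representation. -/
noncomputable def FList : (S : List (Fin n)) → (Λ : Fin n → Fin n → ℕ) → Rep k n Λ →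
    Rep k n (orientAfter Λ S)
  | [], _, M => M
  | x :: xs, Λ, M => FList xs (flipO x Λ) (reflPlus x Λ M)

/-- `S` annihilates `M` : `F(S) M = 0`. -/
def Annihilates (Λ : Fin n → Fin n → ℕ) (S : List (Fin n)) (M : Rep k n Λ) : Prop :=
  IsZeroRep (FList S Λ M)

/-- `M` is preprojective: some `(+)`-admissible sequence annihilates it. -/
def Preprojective (Λ : Fin n → Fin n → ℕ) (M : Rep k n Λ) : Prop :=
  ∃ S, Admissible Λ S ∧ Annihilates Λ S M

/-- `S` is a shortest `(+)`-admissible sequence annihilating `M` : it annihilates `M` and no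
proper subsequence of `S` annihilates `M`.  (This predicate is invariant under `∼`, so it
expresses `S ∼ S_M`.) -/
def IsShortestAnn (Λ : Fin n → Fin n → ℕ) (M : Rep k n Λ) (S : List (Fin n)) : Prop :=
  Admissible Λ S ∧ Annihilates Λ S M ∧
  ∀ S', Admissible Λ S' → Annihilates Λ S' M → Preceq Λ S' S → Sim (edges Λ) S' S

/-- The simple representation `L_x` concentrated at the vertex `x`. -/
def simpleRep (Λ : Fin n → Fin n → ℕ) (x : Fin n) : Rep k n Λ where
  d z := if z = x then 1 else 0
  f _ _ _ := 0

/-- `M(S) = F_{x₁}⁻ F_{x₂}⁻ ⋯ F_{x_{s-1}}⁻ (L_{x_s})`, where `L_{x_s}` is the simple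
(projective) module over `k(Γ, σ_{x_{s-1}} ⋯ σ_{x_1} Λ)` at the vertex `x_s`. -/
noncomputable def Mof : (Λ : Fin n → Fin n → ℕ) → (S : List (Fin n)) → Rep k n Λ
  | Λ, [] => zeroRep k n Λ
  | Λ, [x] => simpleRep Λ x
  | Λ, x :: y :: ys => reflMinus x Λ (Mof (flipO x Λ) (y :: ys))

variable {n : ℕ}

/-! ## The Weyl group -/

/-- The simple reflection `σ_i` attached to a generalized Cartan matrix `A`,
as a linear endomorphism of `ℤⁿ` : `σ_i(v) = v - (∑ l, a_{il} v_l) e_i`. -/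
def sigmaL (A : Fin n → Fin n → ℤ) (i : Fin n) : (Fin n → ℤ) →ₗ[ℤ] (Fin n → ℤ) where
  toFun v := v - (∑ l, A i l * v l) • Pi.single i 1
  map_add' v w := by
    simp only [Pi.add_apply, mul_add, Finset.sum_add_distrib, add_smul]
    abel
  map_smul' c v := by
    simp only [Pi.smul_apply, smul_eq_mul, RingHom.id_apply, smul_sub]
    congr 1
    rw [smul_smul, Finset.mul_sum]
    congr 1
    exact Finset.sum_congr rfl fun l _ => by ring

theorem sigma_invol (A : Fin n → Fin n → ℤ) (hA : ∀ i, A i i = 2) (i : Fin n) :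
    (sigmaL A i).comp (sigmaL A i) = LinearMap.id := by
  apply LinearMap.ext
  intro v
  simp only [LinearMap.comp_apply, LinearMap.id_apply, sigmaL, LinearMap.coe_mk, AddHom.coe_mk]
  set c := ∑ l, A i l * v l with hc
  set s : Fin n → ℤ := Pi.single i 1 with hs
  have h1 : ∑ l, A i l * (v - c • s) l = -c := by
    have h2 : ∀ l, A i l * (v - c • s) l = A i l * v l - c * (A i l * s l) := fun l => by
      simp only [Pi.sub_apply, Pi.smul_apply, smul_eq_mul]
      ring
    rw [Finset.sum_congr rfl fun l _ => h2 l, Finset.sum_sub_distrib, ← Finset.mul_sum]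
    have h3 : ∑ l, A i l * s l = 2 := by
      rw [Finset.sum_eq_single i]
      · simp [hs, hA i]
      · intro b _ hb
        simp [hs, Pi.single_eq_of_ne hb]
      · simp
    rw [h3, ← hc]
    ring
  rw [h1]
  ext j
  simp only [Pi.sub_apply, Pi.smul_apply, smul_eq_mul]
  ring

/-- The simple reflection `σ_i` as an automorphism of `ℤⁿ`. -/
def sigmaE (A : Fin n → Fin n → ℤ) (hA : ∀ i, A i i = 2) (i : Fin n) :
    (Fin n → ℤ) ≃ₗ[ℤ] (Fin n → ℤ) :=
  LinearEquiv.ofLinear (sigmaL A i) (sigmaL A i) (sigma_invol A hA i) (sigma_invol A hA i)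

/-- The length `ℓ(w)`: the least `l ≥ 0` such that `w` is a product of `l` simple
reflections. -/
noncomputable def wordLen (A : Fin n → Fin n → ℤ) (hA : ∀ i, A i i = 2)
    (w : (Fin n → ℤ) ≃ₗ[ℤ] (Fin n → ℤ)) : ℕ :=
  sInf {l | ∃ ys : List (Fin n), ys.length = l ∧ w = (ys.map (sigmaE A hA)).prod}

/-- The word `w(S) = σ_{x_s} ⋯ σ_{x_1}` associated to a sequence `S = x₁, …, x_s`. -/
def wordOf (A : Fin n → Fin n → ℤ) (hA : ∀ i, A i i = 2) (S : List (Fin n)) :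
    (Fin n → ℤ) ≃ₗ[ℤ] (Fin n → ℤ) :=
  ((S.reverse).map (sigmaE A hA)).prod

/-- The symmetric generalized Cartan matrix of the underlying graph of `(Γ, Λ)`. -/
def cartanOf (Λ : Fin n → Fin n → ℕ) : Fin n → Fin n → ℤ :=
  fun i j => if i = j then 2 else -(edges Λ i j : ℤ)

theorem cartan_diag (Λ : Fin n → Fin n → ℕ) : ∀ i, cartanOf Λ i i = 2 := by
  intro i; simp [cartanOf]

/-- The simple reflections of the Weyl group of the underlying graph of `(Γ, Λ)`. -/
def wSig (Λ : Fin n → Fin n → ℕ) : Fin n → ((Fin n → ℤ) ≃ₗ[ℤ] (Fin n → ℤ)) :=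
  sigmaE (cartanOf Λ) (cartan_diag Λ)

/-- `w(S)` for a sequence of vertices of `(Γ, Λ)`. -/
def wordOfSeq (Λ : Fin n → Fin n → ℕ) (S : List (Fin n)) :
    (Fin n → ℤ) ≃ₗ[ℤ] (Fin n → ℤ) :=
  ((S.reverse).map (wSig Λ)).prod

/-- The word `w(S)` is reduced: `ℓ(w(S))` equals the number of letters of `S`. -/
noncomputable def IsReducedSeq (Λ : Fin n → Fin n → ℕ) (S : List (Fin n)) : Prop :=
  wordLen (cartanOf Λ) (cartan_diag Λ) (wordOfSeq Λ S) = S.length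

/-! ## Dynkin graphs of types A, D, E -/

def edgeA (n : ℕ) : Fin n → Fin n → ℕ := fun i j =>
  if (i : ℕ) + 1 = (j : ℕ) ∨ (j : ℕ) + 1 = (i : ℕ) then 1 else 0

def edgeD (n : ℕ) : Fin n → Fin n → ℕ := fun i j =>
  if ((i : ℕ) = 0 ∧ (j : ℕ) = 2) ∨ ((j : ℕ) = 0 ∧ (i : ℕ) = 2) ∨
     ((i : ℕ) = 1 ∧ (j : ℕ) = 2) ∨ ((j : ℕ) = 1 ∧ (i : ℕ) = 2) ∨
     (2 ≤ (i : ℕ) ∧ (i : ℕ) + 1 = (j : ℕ)) ∨ (2 ≤ (j : ℕ) ∧ (j : ℕ) + 1 = (i : ℕ))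
  then 1 else 0

def edgeE (n : ℕ) : Fin n → Fin n → ℕ := fun i j =>
  if ((i : ℕ) + 1 = (j : ℕ) ∧ (j : ℕ) ≤ n - 2) ∨ ((j : ℕ) + 1 = (i : ℕ) ∧ (i : ℕ) ≤ n - 2) ∨
     ((i : ℕ) = 2 ∧ (j : ℕ) = n - 1) ∨ ((j : ℕ) = 2 ∧ (i : ℕ) = n - 1)
  then 1 else 0

/-- The underlying graph (given by its edge-count function `E`) is a Dynkin diagram of
type `A`, `D`, or `E`. -/
def IsDynkinADE (n : ℕ) (E : Fin n → Fin n → ℕ) : Prop :=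
  ∃ e : Fin n ≃ Fin n,
    (∀ i j, E i j = edgeA n (e i) (e j)) ∨
    (4 ≤ n ∧ ∀ i j, E i j = edgeD n (e i) (e j)) ∨
    ((n = 6 ∨ n = 7 ∨ n = 8) ∧ ∀ i j, E i j = edgeE n (e i) (e j))

/-! ## Coxeter-sortable elements -/

/-- Lexicographic comparison of index tuples. -/
def lexLE {s : ℕ} (ι ι' : Fin s → ℕ) : Prop :=
  ι = ι' ∨ ∃ j, (∀ j', j' < j → ι j' = ι' j') ∧ ι j < ι' j

/-- `w` is `c`-sortable for the Coxeter element determined by the half-infinite word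
`cseq` (with dividers every `blockLen` letters): the lexicographically first subsequence
of `cseq` that is a reduced word for `w` defines a sequence of subsets (between adjacent
dividers) that is decreasing under inclusion. -/
def CSortable (A : Fin n → Fin n → ℤ) (hA : ∀ i, A i i = 2) (cseq : ℕ → Fin n)
    (blockLen : ℕ) (w : (Fin n → ℤ) ≃ₗ[ℤ] (Fin n → ℤ)) : Prop :=
  ∃ (s : ℕ) (ι : Fin s → ℕ), StrictMono ι ∧
    w = ((List.ofFn fun j => cseq (ι j)).map (sigmaE A hA)).prod ∧
    wordLen A hA w = s ∧
    (∀ ι' : Fin s → ℕ, StrictMono ι' →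
      w = ((List.ofFn fun j => cseq (ι' j)).map (sigmaE A hA)).prod → lexLE ι ι') ∧
    ∀ m : ℕ, {a : Fin n | ∃ j, (ι j) / blockLen = m + 1 ∧ cseq (ι j) = a} ⊆
             {a : Fin n | ∃ j, (ι j) / blockLen = m ∧ cseq (ι j) = a}


/-- A nonzero non-isomorphism between representations. -/
def RepStep {k : Type} [Field k] {n : ℕ} {Λ : Fin n → Fin n → ℕ} (X Y : Rep k n Λ) : Prop :=
  ∃ f : RepHom X Y, (∃ x v, f.g x v ≠ 0) ∧ ¬ ∀ x, Function.Bijective (f.g x)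

/-- `v` is a minimal element of `D` in the poset `(Γ₀, Λ)`. -/
def MinimalIn {n : ℕ} (Λ : Fin n → Fin n → ℕ) (D : Set (Fin n)) (v : Fin n) : Prop :=
  v ∈ D ∧ ∀ u ∈ D, PathLE Λ u v → u = v

/-- The pairs `(h, v)` of Proposition 3.2(a): `0 < h ≤ r` and `v` a minimal element of
`Supp S_h \ H_Λ(Supp S_{h+1})` (with `Supp S_{r+1} = ∅`). -/
def JoinPair {n : ℕ} (Λ : Fin n → Fin n → ℕ) (segs : List (List (Fin n)))
    (p : ℕ × Fin n) : Prop :=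
  0 < p.1 ∧ p.1 ≤ segs.length ∧
  MinimalIn Λ (suppOf (segs.getD (p.1 - 1) []) \ hull Λ (suppOf (segs.getD p.1 []))) p.2

section weyl

variable {n : ℕ} (A : Fin n → Fin n → ℤ) (hA : ∀ i, A i i = 2)

/-- The product of simple reflections along a word. -/
def prodW (L : List (Fin n)) : (Fin n → ℤ) ≃ₗ[ℤ] (Fin n → ℤ) := (L.map (sigmaE A hA)).prod

/-- The group generated by simple reflections, as a predicate. -/
def InW (g : (Fin n → ℤ) ≃ₗ[ℤ] (Fin n → ℤ)) : Prop := ∃ L, g = prodW A hA L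

theorem sigmaE_apply (i : Fin n) (v : Fin n → ℤ) :
    sigmaE A hA i v = v - (∑ l, A i l * v l) • Pi.single i 1 := rfl

theorem sigmaE_mul_self (i : Fin n) : sigmaE A hA i * sigmaE A hA i = 1 := by
  ext1 v
  exact LinearMap.congr_fun (sigma_invol A hA i) v

theorem sigmaE_single (i j : Fin n) :
    sigmaE A hA i (Pi.single j 1) = Pi.single j 1 - A i j • (Pi.single i 1 : Fin n → ℤ) := by
  rw [sigmaE_apply]
  congr 2
  rw [Finset.sum_eq_single j]
  · simp
  · intro b _ hb
    simp [Pi.single_eq_of_ne hb]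
  · simp

theorem sigmaE_of_ne (i z : Fin n) (h : z ≠ i) (v : Fin n → ℤ) : sigmaE A hA i v z = v z := by
  rw [sigmaE_apply]; simp [Pi.single_eq_of_ne h]

theorem wordLen_le (L : List (Fin n)) : wordLen A hA (prodW A hA L) ≤ L.length :=
  Nat.sInf_le ⟨L, rfl, rfl⟩

theorem wordLen_spec {g} (hg : InW A hA g) :
    ∃ L : List (Fin n), L.length = wordLen A hA g ∧ g = prodW A hA L := by
  obtain ⟨L, hL⟩ := hg
  exact Nat.sInf_mem (s := {l | ∃ ys : List (Fin n), ys.length = l ∧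
    g = (ys.map (sigmaE A hA)).prod}) ⟨L.length, L, rfl, hL⟩

theorem prodW_append (L L' : List (Fin n)) :
    prodW A hA (L ++ L') = prodW A hA L * prodW A hA L' := by simp [prodW]

theorem prodW_single (i : Fin n) : prodW A hA [i] = sigmaE A hA i := by simp [prodW]

theorem InW.mul {g} (hg : InW A hA g) (i : Fin n) : InW A hA (g * sigmaE A hA i) := by
  obtain ⟨L, rfl⟩ := hg
  exact ⟨L ++ [i], by rw [prodW_append, prodW_single]⟩

theorem wordLen_mul_le {g} (hg : InW A hA g) (i : Fin n) :
    wordLen A hA (g * sigmaE A hA i) ≤ wordLen A hA g + 1 := by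
  obtain ⟨L, hL, rfl⟩ := wordLen_spec A hA hg
  rw [← hL, ← prodW_single, ← prodW_append]
  exact (wordLen_le A hA _).trans (by simp)

/-- Right descents. -/
def Desc (g : (Fin n → ℤ) ≃ₗ[ℤ] (Fin n → ℤ)) (i : Fin n) : Prop :=
  wordLen A hA (g * sigmaE A hA i) < wordLen A hA g

theorem exists_desc {g} (hg : InW A hA g) (h1 : g ≠ 1) : ∃ j, Desc A hA g j := by
  obtain ⟨L, hL, hgL⟩ := wordLen_spec A hA hg
  rcases List.eq_nil_or_concat L with rfl | ⟨L', j, rfl⟩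
  · exact absurd (by simpa [prodW] using hgL) h1
  · refine ⟨j, ?_⟩
    unfold Desc
    rw [← hL]
    have : g * sigmaE A hA j = prodW A hA L' := by
      rw [hgL, List.concat_eq_append, prodW_append, prodW_single, mul_assoc, sigmaE_mul_self,
        mul_one]
    rw [this]
    have := wordLen_le A hA L'
    simp; omega

theorem mul_sigma_sigma (g : (Fin n → ℤ) ≃ₗ[ℤ] (Fin n → ℤ)) (i : Fin n) :
    g * sigmaE A hA i * sigmaE A hA i = g := by
  rw [mul_assoc, sigmaE_mul_self, mul_one]

theorem Desc.not_desc {g} {i : Fin n} (h : Desc A hA g i) :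
    ¬ Desc A hA (g * sigmaE A hA i) i := by
  unfold Desc at *
  rw [mul_sigma_sigma]; omega

theorem comm0 {i j : Fin n} (h : A i j = 0) (h' : A j i = 0) :
    sigmaE A hA i * sigmaE A hA j = sigmaE A hA j * sigmaE A hA i := by
  apply LinearEquiv.toLinearMap_injective
  apply LinearMap.pi_ext'
  intro l
  ext1
  change sigmaE A hA i (sigmaE A hA j (Pi.single l 1)) =
    sigmaE A hA j (sigmaE A hA i (Pi.single l 1))
  simp only [sigmaE_single, map_sub, map_smul, h, h']
  module

theorem braid1 {i j : Fin n} (h : A i j = -1) (h' : A j i = -1) :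
    sigmaE A hA i * sigmaE A hA j * sigmaE A hA i =
      sigmaE A hA j * sigmaE A hA i * sigmaE A hA j := by
  apply LinearEquiv.toLinearMap_injective
  apply LinearMap.pi_ext'
  intro l
  ext1
  change sigmaE A hA i (sigmaE A hA j (sigmaE A hA i (Pi.single l 1))) =
    sigmaE A hA j (sigmaE A hA i (sigmaE A hA j (Pi.single l 1)))
  simp only [sigmaE_single, map_sub, map_smul, h, h', hA]
  module

theorem sign_aux (hsym : ∀ i j, A i j = A j i) (hneg : ∀ i j, i ≠ j → A i j ≤ 0) :
    ∀ N : ℕ, ∀ g, InW A hA g → wordLen A hA g = N → ∀ i, ¬ Desc A hA g i →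
      0 ≤ g (Pi.single i 1) ∧ ∀ j, j ≠ i → A i j ≤ -2 →
        0 ≤ g (Pi.single i 1) + g (Pi.single j 1) := by
  intro N
  induction N using Nat.strong_induction_on with
  | _ N ih =>
  intro g hg hN
  have key : ∀ i j, ¬ Desc A hA g i → Desc A hA g j →
      0 ≤ g (Pi.single i 1) ∧ (A i j ≤ -2 → 0 ≤ g (Pi.single i 1) + g (Pi.single j 1)) := by
    intro i j hi hj
    have hij : i ≠ j := by rintro rfl; exact hi hj
    obtain ⟨g', hg'⟩ : ∃ g', g' = g * sigmaE A hA j := ⟨_, rfl⟩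
    have hgW' : InW A hA g' := hg' ▸ hg.mul A hA j
    have hlt : wordLen A hA g' < N := hN ▸ hg' ▸ hj
    have hgg : g = g' * sigmaE A hA j := hg' ▸ (mul_sigma_sigma A hA g j).symm
    have hP := ih _ hlt g' hgW' rfl
    have hnd : ¬ Desc A hA g' j := hg' ▸ hj.not_desc
    obtain ⟨h1, h2⟩ := hP j hnd
    have e1 : g (Pi.single i 1) = g' (Pi.single i 1) - A j i • g' (Pi.single j 1) := by
      conv_lhs => rw [hgg]
      change g' (sigmaE A hA j (Pi.single i 1)) = _
      rw [sigmaE_single, map_sub, map_smul]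
    have e2 : g (Pi.single j 1) = - g' (Pi.single j 1) := by
      conv_lhs => rw [hgg]
      change g' (sigmaE A hA j (Pi.single j 1)) = _
      rw [sigmaE_single, map_sub, map_smul, hA]
      module
    have hcases : A i j = 0 ∨ A i j = -1 ∨ A i j ≤ -2 := by have := hneg i j hij; omega
    rcases hcases with h0 | h0 | h0
    · refine ⟨?_, fun h => by omega⟩
      have hji : A j i = 0 := by rw [hsym, h0]
      rw [e1, hji, zero_smul, sub_zero]
      refine (hP i fun hd => hi ?_).1
      have hle := wordLen_mul_le A hA (hgW'.mul A hA i) j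
      have : g * sigmaE A hA i = g' * sigmaE A hA i * sigmaE A hA j := by
        rw [hgg, mul_assoc, mul_assoc, comm0 A hA hji h0]
      unfold Desc at *
      rw [this]; omega
    · refine ⟨?_, fun h => by omega⟩
      have hji : A j i = -1 := by rw [hsym, h0]
      by_cases hd : Desc A hA g' i
      · obtain ⟨g'', hg''⟩ : ∃ g'', g'' = g' * sigmaE A hA i := ⟨_, rfl⟩
        have hgW'' : InW A hA g'' := hg'' ▸ hgW'.mul A hA i
        have hgg' : g' = g'' * sigmaE A hA i := hg'' ▸ (mul_sigma_sigma A hA g' i).symm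
        have e3 : g (Pi.single i 1) = g'' (Pi.single j 1) := by
          rw [hgg, hgg']
          change g'' (sigmaE A hA i (sigmaE A hA j (Pi.single i 1))) = _
          simp only [sigmaE_single, map_sub, map_smul, h0, hji, hA]
          module
        rw [e3]
        have hlt'' : wordLen A hA g'' < wordLen A hA g' := hg'' ▸ hd
        refine (ih _ (hlt''.trans hlt) g'' hgW'' rfl j fun hd'' => hi ?_).1
        have hle1 := wordLen_mul_le A hA ((hgW''.mul A hA j).mul A hA i) j
        have hle := wordLen_mul_le A hA (hgW''.mul A hA j) i
        have : g * sigmaE A hA i = g'' * sigmaE A hA j * sigmaE A hA i * sigmaE A hA j := by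
          rw [hgg, hgg', mul_assoc, mul_assoc, ← mul_assoc (sigmaE A hA i), braid1 A hA h0 hji]
          simp only [mul_assoc]
        unfold Desc at *
        rw [this]; omega
      · rw [e1, hji]
        have := (hP i hd).1
        exact (add_nonneg this h1).trans_eq (by module)
    · have h3 := h2 i hij (by rw [hsym]; exact h0)
      have h4 : 0 ≤ (-A i j - 1) • g' (Pi.single j 1) := smul_nonneg (by omega) h1
      have h5 : 0 ≤ (-A i j - 2) • g' (Pi.single j 1) := smul_nonneg (by omega) h1
      constructor
      · rw [e1, hsym j i]
        exact (add_nonneg h3 h4).trans_eq (by module)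
      · intro _
        rw [e1, e2, hsym j i]
        exact (add_nonneg h3 h5).trans_eq (by module)
  have c1 : ∀ i, ¬ Desc A hA g i → 0 ≤ g (Pi.single i 1) := by
    intro i hi
    by_cases h1 : g = 1
    · subst h1
      change (0 : Fin n → ℤ) ≤ Pi.single i 1
      exact Pi.single_nonneg.2 zero_le_one
    · obtain ⟨j, hj⟩ := exists_desc A hA hg h1
      exact (key i j hi hj).1
  intro i hi
  refine ⟨c1 i hi, fun j hji h2 => ?_⟩
  by_cases hj : Desc A hA g j
  · exact (key i j hi hj).2 h2
  · exact add_nonneg (c1 i hi) (c1 j hj)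

theorem apply_mul_self (g : (Fin n → ℤ) ≃ₗ[ℤ] (Fin n → ℤ)) (i : Fin n) :
    (g * sigmaE A hA i) (Pi.single i 1) = - g (Pi.single i 1) := by
  change g (sigmaE A hA i (Pi.single i 1)) = _
  rw [sigmaE_single, map_sub, map_smul, hA]
  module

theorem sign_root (hsym : ∀ i j, A i j = A j i) (hneg : ∀ i j, i ≠ j → A i j ≤ 0)
    {g} (hg : InW A hA g) (i : Fin n) :
    0 ≤ g (Pi.single i 1) ∨ g (Pi.single i 1) ≤ 0 := by
  by_cases h : Desc A hA g i
  · right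
    have := (sign_aux A hA hsym hneg _ _ (hg.mul A hA i) rfl i h.not_desc).1
    rw [apply_mul_self] at this
    exact neg_nonneg.1 this
  · left
    exact (sign_aux A hA hsym hneg _ _ hg rfl i h).1

theorem len_of_pos (hsym : ∀ i j, A i j = A j i) (hneg : ∀ i j, i ≠ j → A i j ≤ 0)
    (S : List (Fin n))
    (h : ∀ S1 x S2, S = S1 ++ x :: S2 → 0 ≤ prodW A hA S1 (Pi.single x 1)) :
    wordLen A hA (prodW A hA S) = S.length := by
  induction S using List.reverseRecOn with
  | nil => exact Nat.le_zero.1 (wordLen_le A hA [])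
  | append_singleton S x ih =>
    have ih' := ih fun S1 y S2 e => h S1 y (S2 ++ [x]) (by simp [e])
    have hpos := h S x [] rfl
    have hd : Desc A hA (prodW A hA S * sigmaE A hA x) x := by
      by_contra hd
      have := (sign_aux A hA hsym hneg _ _ (InW.mul A hA ⟨S, rfl⟩ x) rfl x hd).1
      rw [apply_mul_self] at this
      have h0 : prodW A hA S (Pi.single x 1) = 0 := le_antisymm (neg_nonneg.1 this) hpos
      rw [LinearEquiv.map_eq_zero_iff] at h0
      have := congrFun h0 x
      simp at this
    unfold Desc at hd
    rw [mul_sigma_sigma, ← prodW_single, ← prodW_append] at hd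
    have := wordLen_le A hA (S ++ [x])
    simp at this hd ⊢
    omega

theorem prodW_reverse (L : List (Fin n)) : prodW A hA L.reverse = (prodW A hA L)⁻¹ := by
  induction L with
  | nil => simp [prodW]
  | cons x L ih =>
    rw [List.reverse_cons, prodW_append, ih, prodW_single]
    have : prodW A hA (x :: L) = sigmaE A hA x * prodW A hA L := by simp [prodW]
    rw [this, mul_inv_rev]
    congr 1

theorem wordLen_inv_le (L : List (Fin n)) :
    wordLen A hA (prodW A hA L) ≤ wordLen A hA (prodW A hA L.reverse) := by
  obtain ⟨L', h1, h2⟩ := wordLen_spec A hA (g := prodW A hA L.reverse) ⟨_, rfl⟩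
  rw [← h1]
  have : prodW A hA L = prodW A hA L'.reverse := by
    rw [prodW_reverse, ← h2, prodW_reverse, inv_inv]
  rw [this]
  exact (wordLen_le A hA _).trans (by simp)

theorem wordLen_reverse (L : List (Fin n)) :
    wordLen A hA (prodW A hA L.reverse) = wordLen A hA (prodW A hA L) := by
  apply le_antisymm
  · simpa using wordLen_inv_le A hA L.reverse
  · exact wordLen_inv_le A hA L

end weyl

section comb

variable {n : ℕ}

theorem edges_flip (y : Fin n) (Λ : Fin n → Fin n → ℕ) : edges (flipO y Λ) = edges Λ := by
  funext a b
  unfold edges flipO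
  by_cases h : a = y ∨ b = y
  · rw [if_pos h, if_pos h.symm, add_comm]
  · rw [if_neg h, if_neg (fun h' => h h'.symm)]

theorem edges_orientAfter (L : List (Fin n)) : ∀ (Λ : Fin n → Fin n → ℕ),
    edges (orientAfter Λ L) = edges Λ := by
  induction L with
  | nil => intro Λ; rfl
  | cons y L ih => intro Λ; exact (ih _).trans (edges_flip y Λ)

theorem edges_comm (Λ : Fin n → Fin n → ℕ) (a b : Fin n) : edges Λ a b = edges Λ b a := by
  unfold edges; omega

theorem cartan_flip (y : Fin n) (Λ : Fin n → Fin n → ℕ) :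
    cartanOf (flipO y Λ) = cartanOf Λ := by
  unfold cartanOf; rw [edges_flip]

theorem cartan_sym (Λ : Fin n → Fin n → ℕ) (i j : Fin n) : cartanOf Λ i j = cartanOf Λ j i := by
  unfold cartanOf; rw [edges_comm]; simp only [eq_comm]

theorem cartan_neg (Λ : Fin n → Fin n → ℕ) (i j : Fin n) (h : i ≠ j) : cartanOf Λ i j ≤ 0 := by
  unfold cartanOf; rw [if_neg h]; omega

theorem flip_comm (x y : Fin n) (Λ : Fin n → Fin n → ℕ) :
    flipO x (flipO y Λ) = flipO y (flipO x Λ) := by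
  funext a b
  unfold flipO
  split_ifs <;> first | rfl | (exfalso; tauto)

theorem orientAfter_flip (x : Fin n) (L : List (Fin n)) : ∀ Λ : Fin n → Fin n → ℕ,
    orientAfter (flipO x Λ) L = flipO x (orientAfter Λ L) := by
  induction L with
  | nil => intro Λ; rfl
  | cons y L ih =>
    intro Λ
    change orientAfter (flipO y (flipO x Λ)) L = flipO x (orientAfter (flipO y Λ) L)
    rw [flip_comm, ih]

theorem orientAfter_append (L L' : List (Fin n)) : ∀ Λ : Fin n → Fin n → ℕ,
    orientAfter Λ (L ++ L') = orientAfter (orientAfter Λ L) L' := by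
  induction L with
  | nil => intro Λ; rfl
  | cons y L ih => intro Λ; exact ih _

theorem admissible_append (L L' : List (Fin n)) : ∀ Λ : Fin n → Fin n → ℕ,
    Admissible Λ (L ++ L') ↔ Admissible Λ L ∧ Admissible (orientAfter Λ L) L' := by
  induction L with
  | nil => intro Λ; simp [Admissible, orientAfter]
  | cons y L ih =>
    intro Λ
    change IsSink Λ y ∧ Admissible _ (L ++ L') ↔ (IsSink Λ y ∧ _) ∧ _
    rw [ih, and_assoc]; rfl

/-- The Euler form. -/
def euler (Λ : Fin n → Fin n → ℕ) (a b : Fin n → ℤ) : ℤ :=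
  ∑ i, a i * b i - ∑ i, ∑ j, (Λ i j : ℤ) * (a i * b j)

theorem euler_sub_smul_left (Λ : Fin n → Fin n → ℕ) (a a' b : Fin n → ℤ) (c : ℤ) :
    euler Λ (a - c • a') b = euler Λ a b - c * euler Λ a' b := by
  unfold euler
  simp only [Pi.sub_apply, Pi.smul_apply, smul_eq_mul, sub_mul, mul_sub, Finset.sum_sub_distrib,
    Finset.mul_sum]
  have : ∀ i j, (Λ i j : ℤ) * (c * a' i * b j) = c * (Λ i j * (a' i * b j)) := by intros; ring
  have h2 : ∀ i, c * a' i * b i = c * (a' i * b i) := by intros; ring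
  simp only [this, h2]
  ring

theorem euler_sub_smul_right (Λ : Fin n → Fin n → ℕ) (a b b' : Fin n → ℤ) (c : ℤ) :
    euler Λ a (b - c • b') = euler Λ a b - c * euler Λ a b' := by
  unfold euler
  simp only [Pi.sub_apply, Pi.smul_apply, smul_eq_mul, mul_sub, Finset.sum_sub_distrib,
    Finset.mul_sum]
  have : ∀ i j, (Λ i j : ℤ) * (a i * (c * b' j)) = c * (Λ i j * (a i * b' j)) := by intros; ring
  have h2 : ∀ i, a i * (c * b' i) = c * (a i * b' i) := by intros; ring
  simp only [this, h2]
  ring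

theorem euler_single_left (Λ : Fin n → Fin n → ℕ) (y : Fin n) (b : Fin n → ℤ) :
    euler Λ (Pi.single y 1) b = b y - ∑ j, (Λ y j : ℤ) * b j := by
  unfold euler
  congr 1
  · rw [Finset.sum_eq_single y]
    · simp
    · intro i _ hi; simp [Pi.single_eq_of_ne hi]
    · simp
  · rw [Finset.sum_eq_single y]
    · simp
    · intro i _ hi; simp [Pi.single_eq_of_ne hi]
    · simp

theorem euler_single_right (Λ : Fin n → Fin n → ℕ) (y : Fin n) (a : Fin n → ℤ) :
    euler Λ a (Pi.single y 1) = a y - ∑ i, (Λ i y : ℤ) * a i := by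
  unfold euler
  congr 1
  · rw [Finset.sum_eq_single y]
    · simp
    · intro i _ hi; simp [Pi.single_eq_of_ne hi]
    · simp
  · refine Finset.sum_congr rfl fun i _ => ?_
    rw [Finset.sum_eq_single y]
    · simp
    · intro i _ hi; simp [Pi.single_eq_of_ne hi]
    · simp

theorem euler_flip (Λ : Fin n → Fin n → ℕ) (y : Fin n) (hy : IsSink Λ y) (a b : Fin n → ℤ) :
    euler (flipO y Λ) a b = euler Λ a b + (∑ i, (Λ i y : ℤ) * a i) * b y
      - a y * ∑ i, (Λ i y : ℤ) * b i := by
  unfold euler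
  have key : ∀ i j, ((flipO y Λ i j : ℕ) : ℤ) * (a i * b j) =
      (Λ i j : ℤ) * (a i * b j) - (if j = y then (Λ i y : ℤ) * a i * b y else 0)
        + (if i = y then a y * ((Λ j y : ℤ) * b j) else 0) := by
    intro i j
    unfold flipO
    by_cases hi : i = y
    · subst hi
      by_cases hj : j = i
      · subst hj; simp [hy j]
      · simp [hj, hy j]; ring
    · by_cases hj : j = y
      · subst hj; simp [hi, hy i]; ring
      · simp [hi, hj]
  simp only [key, Finset.sum_add_distrib, Finset.sum_sub_distrib]
  have h1 : ∑ i, ∑ j, (if j = y then (Λ i y : ℤ) * a i * b y else 0)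
      = (∑ i, (Λ i y : ℤ) * a i) * b y := by
    rw [Finset.sum_mul]; simp
  have h2 : ∑ i, ∑ j, (if i = y then a y * ((Λ j y : ℤ) * b j) else 0)
      = a y * ∑ i, (Λ i y : ℤ) * b i := by
    rw [Finset.mul_sum, Finset.sum_comm]; simp
  rw [h1, h2]; ring

theorem cartan_sum (Λ : Fin n → Fin n → ℕ) (y : Fin n) (hy : IsSink Λ y) (a : Fin n → ℤ) :
    ∑ l, cartanOf Λ y l * a l = 2 * a y - ∑ i, (Λ i y : ℤ) * a i := by
  have : ∀ l, cartanOf Λ y l * a l = (if l = y then 2 * a y else 0) - (Λ l y : ℤ) * a l := by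
    intro l
    unfold cartanOf edges
    by_cases h : l = y
    · subst h; simp [hy l]
    · rw [if_neg (Ne.symm h), if_neg h, hy l]; push_cast; ring
  simp only [this, Finset.sum_sub_distrib]
  simp

theorem euler_sigma (Λ : Fin n → Fin n → ℕ) (hA) (y : Fin n) (hy : IsSink Λ y)
    (a b : Fin n → ℤ) :
    euler Λ (sigmaE (cartanOf Λ) hA y a) (sigmaE (cartanOf Λ) hA y b)
      = euler (flipO y Λ) a b := by
  rw [sigmaE_apply, sigmaE_apply, euler_sub_smul_left, euler_sub_smul_right, euler_sub_smul_right,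
    euler_single_left, euler_single_left, euler_single_right, euler_flip Λ y hy,
    cartan_sum Λ y hy, cartan_sum Λ y hy]
  have h1 : ∀ b : Fin n → ℤ, ∑ j, (Λ y j : ℤ) * b j = 0 := by
    intro b; simp [hy _]
  rw [h1, h1]
  simp only [Pi.single_eq_same]
  ring

theorem euler_source (Λ : Fin n → Fin n → ℕ) (hA) (y : Fin n) (hy : IsSink Λ y)
    (b : Fin n → ℤ) :
    euler (flipO y Λ) (Pi.single y 1) b = - (sigmaE (cartanOf Λ) hA y b) y := by
  rw [euler_flip Λ y hy, euler_single_left, sigmaE_apply, cartan_sum Λ y hy]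
  have h1 : ∑ j, (Λ y j : ℤ) * b j = 0 := by simp [hy _]
  have h2 : ∑ i, (Λ i y : ℤ) * (Pi.single y 1 : Fin n → ℤ) i = 0 := by
    apply Finset.sum_eq_zero
    intro i _
    by_cases h : i = y
    · subst h; simp [hy i]
    · simp [Pi.single_eq_of_ne h]
  rw [h1, h2]
  simp
  ring

/-- All partial images of `v` under a word are nonnegative. -/
def AllPos (A : Fin n → Fin n → ℤ) (hA : ∀ i, A i i = 2) (v : Fin n → ℤ)
    (L : List (Fin n)) : Prop :=
  ∀ L1 L2, L = L1 ++ L2 → 0 ≤ prodW A hA L2 v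

theorem AllPos.append {A : Fin n → Fin n → ℤ} {hA : ∀ i, A i i = 2} {v : Fin n → ℤ}
    {L L' : List (Fin n)} (h : AllPos A hA v (L ++ L')) : AllPos A hA (prodW A hA L' v) L := by
  intro L1 L2 e
  have := h L1 (L2 ++ L') (by simp [e])
  rw [prodW_append] at this
  exact this

theorem AllPos.tail {A : Fin n → Fin n → ℤ} {hA : ∀ i, A i i = 2} {v : Fin n → ℤ} {y : Fin n}
    {L : List (Fin n)} (h : AllPos A hA v (y :: L)) : AllPos A hA v L :=
  fun L1 L2 e => h (y :: L1) L2 (by simp [e])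

theorem AllPos.cons {A : Fin n → Fin n → ℤ} {hA : ∀ i, A i i = 2} {v : Fin n → ℤ} {y : Fin n}
    {L : List (Fin n)} (h : AllPos A hA v L) (h' : 0 ≤ prodW A hA (y :: L) v) :
    AllPos A hA v (y :: L) := by
  intro L1 L2 e
  cases L1 with
  | nil => simp at e; rw [← e]; exact h'
  | cons z L1 => simp at e; exact h L1 L2 e.2

theorem prodW_cons (A : Fin n → Fin n → ℤ) (hA : ∀ i, A i i = 2) (y : Fin n) (L : List (Fin n))
    (v : Fin n → ℤ) : prodW A hA (y :: L) v = sigmaE A hA y (prodW A hA L v) := by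
  simp [prodW]

theorem lemmaC (A : Fin n → Fin n → ℤ) (hA : ∀ i, A i i = 2) (x : Fin n) (b : Fin n → ℤ)
    (hb : 0 < b x) (L : List (Fin n)) : ∀ Λ : Fin n → Fin n → ℕ, A = cartanOf Λ →
    Admissible Λ L → IsSink (orientAfter Λ L) x → AllPos A hA b L →
    AllPos A hA (Pi.single x 1) L ∧
      0 < euler Λ (prodW A hA L (Pi.single x 1)) (prodW A hA L b) := by
  induction L with
  | nil =>
    intro Λ hAΛ _ hs hpos
    constructor
    · intro L1 L2 e
      have : L2 = [] := by simp at e; exact e.2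
      subst this
      change (0 : Fin n → ℤ) ≤ Pi.single x 1
      exact Pi.single_nonneg.2 zero_le_one
    · change 0 < euler Λ (Pi.single x 1) b
      rw [euler_single_left]
      have h1 : ∑ j, (Λ x j : ℤ) * b j = 0 :=
        Finset.sum_eq_zero fun j _ => by rw [show Λ x j = 0 from hs j]; simp
      rw [h1]; simpa using hb
  | cons y L ih =>
    intro Λ hAΛ hadm hs hpos
    obtain ⟨hy, hadm'⟩ := hadm
    obtain ⟨h1, h2⟩ := ih (flipO y Λ) (by rw [cartan_flip, hAΛ]) hadm' hs hpos.tail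
    subst hAΛ
    refine ⟨h1.cons ?_, ?_⟩
    · by_contra hcon
      have hu := h1 [] L rfl
      have hsg := sign_root (cartanOf Λ) hA (cartan_sym Λ) (cartan_neg Λ)
        (g := prodW (cartanOf Λ) hA (y :: L)) ⟨_, rfl⟩ x
      have hle := hsg.resolve_left hcon
      set u := prodW (cartanOf Λ) hA L (Pi.single x 1) with hudef
      have hform : u = u y • Pi.single y 1 := by
        funext z
        by_cases hz : z = y
        · subst hz; simp
        · have h3 := hle z
          rw [prodW_cons, sigmaE_of_ne _ _ _ _ hz] at h3
          have h4 := hu z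
          simp only [Pi.zero_apply] at h3 h4
          simp [Pi.single_eq_of_ne hz]
          exact le_antisymm h3 h4
      have h5 := hpos [] (y :: L) rfl
      rw [prodW_cons] at h5
      have h6 := h5 y
      have h7 := euler_sub_smul_left (flipO y Λ) 0 (Pi.single y 1)
        (prodW (cartanOf Λ) hA L b) (- u y)
      have h8 : (0 : Fin n → ℤ) - (- u y) • Pi.single y 1 = u := by
        rw [zero_sub, neg_smul, neg_neg]; exact hform.symm
      have h9 : euler (flipO y Λ) 0 (prodW (cartanOf Λ) hA L b) = 0 := by simp [euler]
      rw [h8, h9, euler_source Λ hA y hy] at h7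
      rw [h7] at h2
      have h10 := hu y
      simp only [Pi.zero_apply] at h6 h10
      nlinarith [mul_nonneg h10 h6]
    · rw [prodW_cons, prodW_cons, euler_sigma Λ hA y hy]
      exact h2

theorem prodW_coord (A : Fin n → Fin n → ℤ) (hA : ∀ i, A i i = 2) (U : List (Fin n))
    (v : Fin n → ℤ) (z : Fin n) (hz : z ∉ U) : prodW A hA U v z = v z := by
  induction U with
  | nil => rfl
  | cons y U ih =>
    simp at hz
    rw [prodW_cons, sigmaE_of_ne _ _ _ _ hz.1, ih hz.2]

theorem sink_of_flip {Λ : Fin n → Fin n → ℕ} {x y : Fin n} (hxy : y ≠ x)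
    (he : edges Λ x y = 0) : IsSink (flipO x Λ) y ↔ IsSink Λ y := by
  unfold edges at he
  constructor
  · intro h z
    have := h z
    unfold flipO at this
    by_cases hz : z = x
    · subst hz; omega
    · simpa [hxy, hz] using this
  · intro h z
    unfold flipO
    by_cases hz : z = x
    · subst hz; simp; omega
    · simpa [hxy, hz] using h z

theorem admissible_flip {x : Fin n} (L : List (Fin n)) : ∀ {Λ : Fin n → Fin n → ℕ},
    (∀ y ∈ L, y ≠ x ∧ edges Λ x y = 0) →
    (Admissible (flipO x Λ) L ↔ Admissible Λ L) := by
  induction L with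
  | nil => intro Λ _; rfl
  | cons y L ih =>
    intro Λ h
    obtain ⟨h1, h2⟩ := h y (by simp)
    change IsSink (flipO x Λ) y ∧ Admissible (flipO y (flipO x Λ)) L ↔
      IsSink Λ y ∧ Admissible (flipO y Λ) L
    rw [sink_of_flip h1 h2, ← flip_comm, ih]
    intro z hz
    rw [edges_flip]
    exact h z (by simp [hz])

theorem sink_after {x : Fin n} (L : List (Fin n)) : ∀ {Λ : Fin n → Fin n → ℕ},
    (∀ y ∈ L, y ≠ x ∧ edges Λ x y = 0) →
    (IsSink (orientAfter Λ L) x ↔ IsSink Λ x) := by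
  induction L with
  | nil => intro Λ _; rfl
  | cons y L ih =>
    intro Λ h
    obtain ⟨h1, h2⟩ := h y (by simp)
    change IsSink (orientAfter (flipO y Λ) L) x ↔ _
    rw [ih, sink_of_flip h1.symm (by rw [edges_comm]; exact h2)]
    intro z hz
    rw [edges_flip]
    exact h z (by simp [hz])

theorem sim_move (E : Fin n → Fin n → ℕ) (x : Fin n) (L : List (Fin n)) :
    ∀ S1, (∀ y ∈ L, E x y = 0) → Sim E (S1 ++ x :: L) (S1 ++ L ++ [x]) := by
  induction L with
  | nil => intro S1 _; simp; exact Relation.ReflTransGen.refl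
  | cons y L ih =>
    intro S1 h
    refine Relation.ReflTransGen.head (SwapRel.swap S1 L x y (h y (by simp))) ?_
    have := ih (S1 ++ [y]) fun z hz => h z (by simp [hz])
    unfold Sim at this
    simpa using this

theorem sim_length {E : Fin n → Fin n → ℕ} {L L' : List (Fin n)} (h : Sim E L L') :
    L.length = L'.length := by
  induction h with
  | refl => rfl
  | tail _ h ih => rw [ih]; cases h; simp

end comb

section reps

variable {k : Type} [Field k] {n : ℕ}

theorem castL_symm_apply {m m' : ℕ} (h : m = m') (v : Fin m' → k) :
    castL k h (castL k h.symm v) = v := by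
  subst h; rfl

theorem castL_castL {m m' : ℕ} (h : m = m') (h' : m' = m) (v : Fin m' → k) :
    castL k h (castL k h' v) = v := by
  subst h; rfl

theorem reflPlus_spec (y : Fin n) (Λ : Fin n → Fin n → ℕ) (M : Rep k n Λ) :
    ∃ (E : ∀ z, (Fin ((reflPlus y Λ M).d z) → k) →ₗ[k] (Fin (M.d z) → k))
      (I : ∀ z, (Fin (M.d z) → k) →ₗ[k] (Fin ((reflPlus y Λ M).d z) → k))
      (ι : (Fin ((reflPlus y Λ M).d y) → k) →ₗ[k] ((p : Arin Λ y) → (Fin (M.d p.1) → k))),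
      (∀ z, z ≠ y → ∀ v, E z (I z v) = v) ∧ (∀ z, z ≠ y → ∀ v, I z (E z v) = v) ∧
      (∀ a b, a ≠ y → b ≠ y → ∀ (i : Fin (flipO y Λ a b)) (j : Fin (Λ a b)), i.val = j.val →
        ∀ v, E b ((reflPlus y Λ M).f a b i v) = M.f a b j (E a v)) ∧
      Function.Injective ι ∧ (∀ w, inMap Λ M y w = 0 ↔ ∃ v, ι v = w) ∧
      (∀ b, b ≠ y → ∀ (i : Fin (flipO y Λ y b)) (j : Fin (Λ b y)), i.val = j.val →
        ∀ v, E b ((reflPlus y Λ M).f y b i v) = ι v ⟨b, j⟩) := by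
  refine ⟨fun z => if h : z = y then 0 else
      (castL k (show (reflPlus y Λ M).d z = M.d z from if_neg h)).toLinearMap,
    fun z => if h : z = y then 0 else
      (castL k (show (reflPlus y Λ M).d z = M.d z from if_neg h).symm).toLinearMap,
    (LinearMap.ker (inMap Λ M y)).subtype ∘ₗ (kerEquiv Λ M y).symm.toLinearMap ∘ₗ
      (castL k (show (reflPlus y Λ M).d y = _ from if_pos rfl)).toLinearMap,
    ?_, ?_, ?_, ?_, ?_, ?_⟩
  · intro z hz v
    simp only [dif_neg hz]
    exact castL_castL _ _ v
  · intro z hz v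
    simp only [dif_neg hz]
    exact castL_castL _ _ v
  · intro a b ha hb i j hij v
    have hj : j = Fin.cast (by simp [flipO, ha, hb]) i := Fin.ext hij.symm
    subst hj
    have hf : (reflPlus y Λ M).f a b i =
        (castL k (show M.d b = (reflPlus y Λ M).d b from (if_neg hb).symm)).toLinearMap ∘ₗ
          M.f a b (Fin.cast (by simp [flipO, ha, hb]) i) ∘ₗ
          (castL k (show (reflPlus y Λ M).d a = M.d a from if_neg ha)).toLinearMap :=
      (dif_neg ha).trans (dif_neg hb)
    rw [hf]
    simp only [dif_neg ha, dif_neg hb, LinearMap.coe_comp, LinearEquiv.coe_coe,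
      Function.comp]
    rw [castL_castL]
  · simp only [LinearMap.coe_comp, LinearEquiv.coe_coe]
    exact Subtype.val_injective.comp
      ((kerEquiv Λ M y).symm.injective.comp (LinearEquiv.injective _))
  · intro w
    constructor
    · intro hw
      obtain ⟨u, hu⟩ := (kerEquiv Λ M y).symm.surjective ⟨w, hw⟩
      obtain ⟨v, hv⟩ := (castL k (show (reflPlus y Λ M).d y = _ from if_pos rfl)).surjective u
      refine ⟨v, ?_⟩
      simp only [LinearMap.coe_comp, LinearEquiv.coe_coe, Function.comp]
      rw [hv, hu]; rfl
    · rintro ⟨v, rfl⟩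
      exact LinearMap.mem_ker.1 (Subtype.property _)
  · intro b hb i j hij v
    have hj : j = Fin.cast (by simp [flipO]) i := Fin.ext hij.symm
    subst hj
    have hf : (reflPlus y Λ M).f y b i =
        (castL k (show M.d b = (reflPlus y Λ M).d b from (if_neg hb).symm)).toLinearMap ∘ₗ
          (LinearMap.proj (φ := fun p : Arin Λ y => Fin (M.d p.1) → k)
            (⟨b, Fin.cast (by simp [flipO]) i⟩ : Arin Λ y)) ∘ₗ
          (LinearMap.ker (inMap Λ M y)).subtype ∘ₗ
          (kerEquiv Λ M y).symm.toLinearMap ∘ₗ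
          (castL k (show (reflPlus y Λ M).d y = _ from if_pos rfl)).toLinearMap :=
      (dif_pos rfl).trans (dif_neg hb)
    rw [hf]
    simp only [dif_neg hb, LinearMap.coe_comp, LinearEquiv.coe_coe,
      Function.comp]
    rw [castL_castL]
    rfl

/-- Map into the sum over the arrows at `y`, for a representation with `y` a source. -/
def outM (y : Fin n) (Λ : Fin n → Fin n → ℕ) (X : Rep k n (flipO y Λ)) :
    (Fin (X.d y) → k) →ₗ[k] ((p : Arin Λ y) → (Fin (X.d p.1) → k)) :=
  LinearMap.pi fun p => X.f y p.1 (Fin.cast (by simp [flipO]) p.2)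

/-- The cokernel coordinates. -/
noncomputable def cokE (y : Fin n) (Λ : Fin n → Fin n → ℕ) (X : Rep k n (flipO y Λ)) :
    (((p : Arin Λ y) → (Fin (X.d p.1) → k)) ⧸ LinearMap.range (outM y Λ X)) ≃ₗ[k]
      (Fin (Module.finrank k (((p : Arin Λ y) → (Fin (X.d p.1) → k)) ⧸
        LinearMap.range (outM y Λ X))) → k) :=
  (Module.finBasis k _).equivFun

/-- Negative reflection with the cokernel indexed by incoming arrows. -/
noncomputable def rMinus (y : Fin n) (Λ : Fin n → Fin n → ℕ)
    (X : Rep k n (flipO y Λ)) : Rep k n Λ where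
  d z := if z = y then
      Module.finrank k (((p : Arin Λ y) → (Fin (X.d p.1) → k)) ⧸ LinearMap.range (outM y Λ X))
    else X.d z
  f a b i :=
    if hb : b = y then
      if ha : a = y then 0
      else
        (castL k (if_pos hb).symm).toLinearMap ∘ₗ (cokE y Λ X).toLinearMap ∘ₗ
          (LinearMap.range (outM y Λ X)).mkQ ∘ₗ
          (LinearMap.single k (fun p : Arin Λ y => Fin (X.d p.1) → k)
            (⟨a, Fin.cast (by rw [hb]) i⟩ : Arin Λ y)) ∘ₗ
          (castL k (if_neg ha)).toLinearMap
    else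
      if ha : a = y then 0
      else
        (castL k (if_neg hb).symm).toLinearMap ∘ₗ
          X.f a b (Fin.cast (by simp [flipO, ha, hb]) i) ∘ₗ
          (castL k (if_neg ha)).toLinearMap

theorem rMinus_spec (y : Fin n) (Λ : Fin n → Fin n → ℕ) (X : Rep k n (flipO y Λ)) :
    ∃ (G : ∀ z, (Fin (X.d z) → k) →ₗ[k] (Fin ((rMinus y Λ X).d z) → k))
      (I : ∀ z, (Fin ((rMinus y Λ X).d z) → k) →ₗ[k] (Fin (X.d z) → k))
      (π : ((p : Arin Λ y) → (Fin (X.d p.1) → k)) →ₗ[k] (Fin ((rMinus y Λ X).d y) → k)),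
      (∀ z, z ≠ y → ∀ v, G z (I z v) = v) ∧ (∀ z, z ≠ y → ∀ v, I z (G z v) = v) ∧
      (∀ a b, a ≠ y → b ≠ y → ∀ (i : Fin (Λ a b)) (j : Fin (flipO y Λ a b)), i.val = j.val →
        ∀ v, (rMinus y Λ X).f a b i (G a v) = G b (X.f a b j v)) ∧
      Function.Surjective π ∧ (∀ w, π w = 0 ↔ ∃ v, outM y Λ X v = w) ∧
      (∀ a, a ≠ y → ∀ (i : Fin (Λ a y)),
        ∀ v, (rMinus y Λ X).f a y i (G a v) = π (Pi.single (⟨a, i⟩ : Arin Λ y) v)) := by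
  refine ⟨fun z => if h : z = y then 0 else
      (castL k (show (rMinus y Λ X).d z = X.d z from if_neg h).symm).toLinearMap,
    fun z => if h : z = y then 0 else
      (castL k (show (rMinus y Λ X).d z = X.d z from if_neg h)).toLinearMap,
    (castL k (show (rMinus y Λ X).d y = _ from if_pos rfl).symm).toLinearMap ∘ₗ
      (cokE y Λ X).toLinearMap ∘ₗ (LinearMap.range (outM y Λ X)).mkQ,
    ?_, ?_, ?_, ?_, ?_, ?_⟩
  · intro z hz v
    simp only [dif_neg hz]
    exact castL_castL _ _ v
  · intro z hz v
    simp only [dif_neg hz]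
    exact castL_castL _ _ v
  · intro a b ha hb i j hij v
    have hj : j = Fin.cast (by simp [flipO, ha, hb]) i := Fin.ext hij.symm
    subst hj
    have hf : (rMinus y Λ X).f a b i =
        (castL k (show X.d b = (rMinus y Λ X).d b from (if_neg hb).symm)).toLinearMap ∘ₗ
          X.f a b (Fin.cast (by simp [flipO, ha, hb]) i) ∘ₗ
          (castL k (show (rMinus y Λ X).d a = X.d a from if_neg ha)).toLinearMap :=
      (dif_neg hb).trans (dif_neg ha)
    rw [hf]
    simp only [dif_neg ha, dif_neg hb, LinearMap.coe_comp, LinearEquiv.coe_coe,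
      Function.comp]
    rw [castL_castL]
  · simp only [LinearMap.coe_comp, LinearEquiv.coe_coe]
    exact (LinearEquiv.surjective _).comp
      ((cokE y Λ X).surjective.comp (Submodule.mkQ_surjective _))
  · intro w
    simp only [LinearMap.coe_comp, LinearEquiv.coe_coe, Function.comp]
    rw [LinearEquiv.map_eq_zero_iff, LinearEquiv.map_eq_zero_iff, Submodule.mkQ_apply,
      Submodule.Quotient.mk_eq_zero, LinearMap.mem_range]
  · intro a ha i v
    have hf : (rMinus y Λ X).f a y i =
        (castL k (show _ = (rMinus y Λ X).d y from (if_pos rfl).symm)).toLinearMap ∘ₗ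
          (cokE y Λ X).toLinearMap ∘ₗ
          (LinearMap.range (outM y Λ X)).mkQ ∘ₗ
          (LinearMap.single k (fun p : Arin Λ y => Fin (X.d p.1) → k)
            (⟨a, i⟩ : Arin Λ y)) ∘ₗ
          (castL k (show (rMinus y Λ X).d a = X.d a from if_neg ha)).toLinearMap :=
      (dif_pos rfl).trans (dif_neg ha)
    rw [hf]
    simp only [dif_neg ha, LinearMap.coe_comp, LinearEquiv.coe_coe,
      Function.comp]
    rw [castL_castL]
    rfl

theorem rMinus_dim (y : Fin n) (Λ : Fin n → Fin n → ℕ) (hy : IsSink Λ y)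
    (X : Rep k n (flipO y Λ)) (hinj : Function.Injective (outM y Λ X)) (hA) :
    (fun z => ((rMinus y Λ X).d z : ℤ)) =
      sigmaE (cartanOf Λ) hA y (fun z => (X.d z : ℤ)) := by
  funext z
  by_cases hz : z = y
  · subst hz
    have h1 : (rMinus z Λ X).d z = Module.finrank k (((p : Arin Λ z) → (Fin (X.d p.1) → k)) ⧸
      LinearMap.range (outM z Λ X)) := if_pos rfl
    have h2 := Submodule.finrank_quotient_add_finrank (LinearMap.range (outM z Λ X))
    rw [LinearMap.finrank_range_of_inj hinj] at h2
    have h3 : Module.finrank k ((p : Arin Λ z) → (Fin (X.d p.1) → k))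
        = ∑ i, Λ i z * X.d i := by
      rw [Module.finrank_pi_fintype, Fintype.sum_sigma]
      simp
    rw [h3] at h2
    simp only [Module.finrank_fin_fun] at h2
    rw [sigmaE_apply, cartan_sum Λ z hy, h1]
    simp only [Pi.sub_apply, Pi.smul_apply, Pi.single_eq_same, smul_eq_mul, mul_one]
    have h4 : (∑ i, (Λ i z : ℤ) * (X.d i : ℤ)) = ((∑ i, Λ i z * X.d i : ℕ) : ℤ) := by
      push_cast; rfl
    rw [h4, ← h2]; push_cast; ring
  · rw [sigmaE_of_ne _ _ _ _ hz]
    exact congrArg _ (if_neg hz)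

/-- Every endomorphism is a scalar. -/
def Brick {Λ : Fin n → Fin n → ℕ} (X : Rep k n Λ) : Prop :=
  ∀ φ : RepHom X X, ∃ c : k, ∀ z v, φ.g z v = c • v

/-- There is a nonzero morphism. -/
def HasHom {Λ : Fin n → Fin n → ℕ} (X M : Rep k n Λ) : Prop :=
  ∃ φ : RepHom X M, ∃ z v, φ.g z v ≠ 0

end reps

section step

variable {k : Type} [Field k] {n : ℕ}

theorem noarrow_flip {y : Fin n} {Λ : Fin n → Fin n → ℕ} (hy : IsSink Λ y) (a : Fin n)
    (i : Fin (flipO y Λ a y)) : False := by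
  have h : flipO y Λ a y = 0 := by simp [flipO, hy a]
  exact (Fin.cast h i).elim0

theorem noarrow {y : Fin n} {Λ : Fin n → Fin n → ℕ} (hy : IsSink Λ y) (a : Fin n)
    (i : Fin (Λ y a)) : False := (Fin.cast (hy a) i).elim0

theorem arin_ne {y : Fin n} {Λ : Fin n → Fin n → ℕ} (hy : IsSink Λ y) (p : Arin Λ y) :
    p.1 ≠ y := by
  obtain ⟨a, i⟩ := p
  rintro h
  simp only at h
  subst h
  exact noarrow hy _ i

theorem inMap_apply (Λ : Fin n → Fin n → ℕ) (M : Rep k n Λ) (x : Fin n) (w) :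
    inMap Λ M x w = ∑ p : Arin Λ x, M.f p.1 x p.2 (w p) := by
  simp [inMap, LinearMap.sum_apply]

theorem hom_zero {y : Fin n} {Λ : Fin n → Fin n → ℕ} (hy : IsSink Λ y)
    (X : Rep k n (flipO y Λ)) (M : Rep k n Λ) (g : RepHom X (reflPlus y Λ M))
    (h : ∀ z, z ≠ y → ∀ v, g.g z v = 0) : ∀ z v, g.g z v = 0 := by
  obtain ⟨E, I, ι, h1, h2, h3, h4, h5, h6⟩ := reflPlus_spec y Λ M
  intro z v
  by_cases hz : z = y
  · subst hz
    apply h4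
    rw [map_zero]
    funext p
    have hp := arin_ne hy p
    obtain ⟨b, j⟩ := p
    rw [← h6 b hp (Fin.cast (by simp [flipO]) j) j rfl, ← g.comm, h b hp, map_zero]
    rfl
  · exact h z hz v

theorem step_inj {y : Fin n} {Λ : Fin n → Fin n → ℕ} (hy : IsSink Λ y)
    (X : Rep k n (flipO y Λ)) (M : Rep k n Λ) (hX : Brick X) (hh : HasHom X (reflPlus y Λ M)) :
    Function.Injective (outM y Λ X) := by
  obtain ⟨g, z0, w0, hg⟩ := hh
  rw [← LinearMap.ker_eq_bot, LinearMap.ker_eq_bot']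
  intro v0 hv0
  by_contra hne
  have hne' : ∃ j, v0 j ≠ 0 := by
    by_contra hc
    push Not at hc
    exact hne (funext hc)
  obtain ⟨j, hj⟩ := hne'
  have hf : ∀ b (i : Fin (flipO y Λ y b)), X.f y b i v0 = 0 := by
    intro b i
    exact congrFun hv0 (⟨b, Fin.cast (by simp [flipO]) i⟩ : Arin Λ y)
  let φ : RepHom X X :=
    { g := Function.update (fun z => (0 : (Fin (X.d z) → k) →ₗ[k] (Fin (X.d z) → k))) y
        ((LinearMap.proj j).smulRight v0)
      comm := by
        intro a b i v
        by_cases hb : b = y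
        · subst hb; exact (noarrow_flip hy _ i).elim
        · rw [Function.update_of_ne hb]
          by_cases ha : a = y
          · subst ha
            rw [Function.update_self]
            simp [hf]
          · rw [Function.update_of_ne ha]; simp }
  obtain ⟨c, hc⟩ := hX φ
  have hcy := hc y v0
  have hc0 : c ≠ 0 := by
    rintro rfl
    have h1 : φ.g y v0 = v0 j • v0 := by
      simp [φ]
    rw [h1, zero_smul] at hcy
    exact (smul_ne_zero hj hne) hcy
  have hz : ∀ z, z ≠ y → ∀ v : Fin (X.d z) → k, v = 0 := by
    intro z hz v
    have h1 := hc z v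
    have h2 : φ.g z v = 0 := by
      simp [φ, Function.update_of_ne hz]
    rw [h2] at h1
    exact (smul_eq_zero.1 h1.symm).resolve_left hc0
  exact hg (hom_zero hy X M g (fun z hzy v => by rw [hz z hzy v, map_zero]) z0 w0)

theorem step_brick {y : Fin n} {Λ : Fin n → Fin n → ℕ} (hy : IsSink Λ y)
    (X : Rep k n (flipO y Λ)) (hX : Brick X) (hinj : Function.Injective (outM y Λ X)) :
    Brick (rMinus y Λ X) := by
  intro φ
  obtain ⟨G, I, π, h1, h2, h3, h4, h5, h6⟩ := rMinus_spec y Λ X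
  let ψ : ∀ z, (Fin (X.d z) → k) →ₗ[k] (Fin (X.d z) → k) := fun z => I z ∘ₗ φ.g z ∘ₗ G z
  let Ψ : ((p : Arin Λ y) → (Fin (X.d p.1) → k)) →ₗ[k] ((p : Arin Λ y) → (Fin (X.d p.1) → k)) :=
    LinearMap.pi fun p => ψ p.1 ∘ₗ LinearMap.proj p
  have hΨ : ∀ w, π (Ψ w) = φ.g y (π w) := by
    have : π ∘ₗ Ψ = φ.g y ∘ₗ π := by
      apply LinearMap.pi_ext
      intro p v
      have hp := arin_ne hy p
      simp only [LinearMap.comp_apply]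
      have hs : Ψ (Pi.single p v) = Pi.single p (ψ p.1 v) := by
        funext q
        by_cases hq : q = p
        · subst hq; simp [Ψ]
        · simp [Ψ, Pi.single_eq_of_ne hq]
      rw [hs]
      obtain ⟨a, i⟩ := p
      rw [← h6 a hp, ← h6 a hp, φ.comm]
      simp only [ψ, LinearMap.comp_apply]
      rw [h1 a hp]
    exact fun w => LinearMap.congr_fun this w
  obtain ⟨r, hr⟩ := LinearMap.exists_leftInverse_of_injective (outM y Λ X)
    (LinearMap.ker_eq_bot.2 hinj)
  let θ := r ∘ₗ Ψ ∘ₗ outM y Λ X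
  have hθ : ∀ v, outM y Λ X (θ v) = Ψ (outM y Λ X v) := by
    intro v
    have h0 : π (Ψ (outM y Λ X v)) = 0 := by
      rw [hΨ, (h5 _).2 ⟨v, rfl⟩, map_zero]
    obtain ⟨u, hu⟩ := (h5 _).1 h0
    have : θ v = u := by
      simp only [θ, LinearMap.comp_apply]
      rw [← hu]
      exact LinearMap.congr_fun hr u
    rw [this, hu]
  let ψ' : RepHom X X :=
    { g := Function.update ψ y θ
      comm := by
        intro a b i v
        by_cases hb : b = y
        · subst hb; exact (noarrow_flip hy _ i).elim
        · rw [Function.update_of_ne hb]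
          by_cases ha : a = y
          · subst ha
            rw [Function.update_self]
            exact (congrFun (hθ v) (⟨b, Fin.cast (by simp [flipO]) i⟩ : Arin Λ a)).symm
          · rw [Function.update_of_ne ha]
            simp only [ψ, LinearMap.comp_apply]
            rw [← h3 a b ha hb (Fin.cast (by simp [flipO, ha, hb]) i) i rfl, φ.comm,
              ← h1 a ha (φ.g a (G a v)), h3 a b ha hb _ i rfl, h2 b hb, h2 a ha] }
  obtain ⟨c, hc⟩ := hX ψ'
  have hψ : ∀ z, z ≠ y → ∀ v, ψ z v = c • v := by
    intro z hz v
    rw [← hc z v]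
    simp only [ψ', Function.update_of_ne hz]
  refine ⟨c, fun z v => ?_⟩
  by_cases hz : z = y
  · subst hz
    obtain ⟨w, rfl⟩ := h4 v
    rw [← hΨ, ← map_smul]
    congr 1
    funext p
    exact hψ p.1 (arin_ne hy p) (w p)
  · rw [← h1 z hz (φ.g z v)]
    have := hψ z hz (I z v)
    simp only [ψ, LinearMap.comp_apply] at this
    rw [h1 z hz] at this
    rw [this, map_smul, h1 z hz]

theorem step_hom {y : Fin n} {Λ : Fin n → Fin n → ℕ} (hy : IsSink Λ y)
    (X : Rep k n (flipO y Λ)) (M : Rep k n Λ) (hh : HasHom X (reflPlus y Λ M)) :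
    HasHom (rMinus y Λ X) M := by
  obtain ⟨g, z0, w0, hg⟩ := hh
  have hnz : ∃ z, z ≠ y ∧ ∃ v, g.g z v ≠ 0 := by
    by_contra hc
    push Not at hc
    exact hg (hom_zero hy X M g hc z0 w0)
  obtain ⟨E, J, ι, e1, e2, e3, e4, e5, e6⟩ := reflPlus_spec y Λ M
  obtain ⟨G, I, π, h1, h2, h3, h4, h5, h6⟩ := rMinus_spec y Λ X
  let T : ((p : Arin Λ y) → (Fin (X.d p.1) → k)) →ₗ[k] ((p : Arin Λ y) → (Fin (M.d p.1) → k)) :=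
    LinearMap.pi fun p => E p.1 ∘ₗ g.g p.1 ∘ₗ LinearMap.proj p
  obtain ⟨s, hs⟩ := LinearMap.exists_rightInverse_of_surjective π (LinearMap.range_eq_top.2 h4)
  have hs' : ∀ v, π (s v) = v := fun v => LinearMap.congr_fun hs v
  let hY := inMap Λ M y ∘ₗ T ∘ₗ s
  have hout : ∀ v, inMap Λ M y (T (outM y Λ X v)) = 0 := by
    intro v
    refine (e5 _).2 ⟨g.g y v, ?_⟩
    funext p
    have hp := arin_ne hy p
    obtain ⟨b, j⟩ := p
    rw [← e6 b hp (Fin.cast (by simp [flipO]) j) j rfl, ← g.comm]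
    rfl
  have hYπ : ∀ w, hY (π w) = inMap Λ M y (T w) := by
    intro w
    have h0 : π (s (π w) - w) = 0 := by rw [map_sub, hs', sub_self]
    obtain ⟨u, hu⟩ := (h5 _).1 h0
    have h7 := hout u
    rw [hu, map_sub, map_sub, sub_eq_zero] at h7
    exact h7
  refine ⟨⟨Function.update (fun z => E z ∘ₗ g.g z ∘ₗ I z) y hY, ?_⟩, ?_⟩
  · intro a b i v
    by_cases ha : a = y
    · subst ha; exact (noarrow hy _ i).elim
    · rw [Function.update_of_ne ha]
      obtain ⟨u, rfl⟩ : ∃ u, v = G a u := ⟨I a v, (h1 a ha v).symm⟩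
      simp only [LinearMap.comp_apply]
      rw [h2 a ha]
      by_cases hb : b = y
      · subst hb
        rw [Function.update_self, h6 a ha, hYπ, inMap_apply]
        rw [Finset.sum_eq_single (⟨a, i⟩ : Arin Λ b)]
        · simp [T]
        · intro q _ hq
          simp [T, Pi.single_eq_of_ne hq]
        · simp
      · rw [Function.update_of_ne hb]
        simp only [LinearMap.comp_apply]
        rw [h3 a b ha hb i (Fin.cast (by simp [flipO, ha, hb]) i) rfl, h2 b hb, g.comm,
          e3 a b ha hb _ i rfl]
  · obtain ⟨z, hz, v, hv⟩ := hnz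
    refine ⟨z, G z v, ?_⟩
    simp only [Function.update_of_ne hz, LinearMap.comp_apply]
    rw [h2 z hz]
    intro h0
    apply hv
    rw [← e2 z hz (g.g z v), h0, map_zero]

theorem lemmaR (A : Fin n → Fin n → ℤ) (hA : ∀ i, A i i = 2) (x : Fin n) (L : List (Fin n)) :
    ∀ (Λ : Fin n → Fin n → ℕ) (M : Rep k n Λ), A = cartanOf Λ → Admissible Λ L →
      IsSink (orientAfter Λ L) x → (FList L Λ M).d x ≠ 0 →
      AllPos A hA (Pi.single x 1) L ∧ ∃ X : Rep k n Λ, Brick X ∧ HasHom X M ∧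
        (fun z => (X.d z : ℤ)) = prodW A hA L (Pi.single x 1) := by
  induction L with
  | nil =>
    intro Λ M hAΛ _ hx hd
    have h0 : prodW A hA [] (Pi.single x 1) = Pi.single x 1 := by simp [prodW]
    refine ⟨?_, simpleRep Λ x, ?_, ?_, ?_⟩
    · intro L1 L2 h
      obtain ⟨rfl, rfl⟩ := List.append_eq_nil_iff.1 h.symm
      rw [h0, Pi.single_nonneg]; exact zero_le_one
    · intro φ
      let e : (Fin ((simpleRep (k := k) Λ x).d x) → k) := fun _ => 1
      have hd1 : (simpleRep (k := k) Λ x).d x = 1 := if_pos rfl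
      refine ⟨φ.g x e ⟨0, by rw [hd1]; exact Nat.one_pos⟩, fun z v => ?_⟩
      by_cases hz : z = x
      · subst hz
        have hsub : Subsingleton (Fin ((simpleRep (k := k) Λ z).d z)) := by
          rw [hd1]; infer_instance
        have hv : v = (v ⟨0, by rw [hd1]; exact Nat.one_pos⟩) • e := by
          funext j
          simp only [e, Pi.smul_apply, smul_eq_mul, mul_one]
          congr 1
          exact Subsingleton.elim _ _
        funext j
        conv_lhs => rw [hv]
        rw [map_smul]
        simp only [Pi.smul_apply, smul_eq_mul]
        have hj : j = ⟨0, by rw [hd1]; exact Nat.one_pos⟩ := Subsingleton.elim _ _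
        rw [hj, mul_comm]
      · have hd0 : (simpleRep (k := k) Λ x).d z = 0 := if_neg hz
        funext j
        exact (Fin.cast hd0 j).elim0
    · have hd1 : (simpleRep (k := k) Λ x).d x = 1 := if_pos rfl
      let j0 : Fin ((simpleRep (k := k) Λ x).d x) := ⟨0, by rw [hd1]; exact Nat.one_pos⟩
      have hMd : M.d x ≠ 0 := hd
      have hx0 : IsSink Λ x := hx
      let i0 : Fin (M.d x) := ⟨0, Nat.pos_of_ne_zero hMd⟩
      refine ⟨⟨Function.update (fun z => 0) x
        ((LinearMap.proj j0).smulRight (Pi.single i0 (1 : k))), ?_⟩, x, fun _ => 1, ?_⟩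
      · intro a b i v
        by_cases ha : a = x
        · subst ha; exact (noarrow hx0 _ i).elim
        · rw [Function.update_of_ne ha]
          have hf : (simpleRep (k := k) Λ x).f a b i v = 0 := rfl
          rw [hf, map_zero]
          exact (map_zero (M.f a b i)).symm
      · simp only [Function.update_self]
        intro h
        have := congrFun h i0
        simp at this
    · rw [h0]
      funext z
      by_cases hz : z = x
      · subst hz; simp [simpleRep]
      · simp [simpleRep, hz]
  | cons y L ih =>
    intro Λ M hAΛ hadm hx hd
    obtain ⟨hpos, X, hX, hh, hdim⟩ := ih (flipO y Λ) (reflPlus y Λ M)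
      (hAΛ.trans (cartan_flip y Λ).symm) hadm.2 hx hd
    have hinj := step_inj hadm.1 X M hX hh
    have hdim' : (fun z => ((rMinus y Λ X).d z : ℤ)) = prodW A hA (y :: L) (Pi.single x 1) := by
      subst hAΛ
      rw [rMinus_dim y Λ hadm.1 X hinj hA, hdim, prodW_cons]
    refine ⟨hpos.cons ?_, rMinus y Λ X, step_brick hadm.1 X hX hinj, step_hom hadm.1 X M hh,
      hdim'⟩
    rw [← hdim']
    intro z
    exact Int.natCast_nonneg _

end step

section agree

variable {k : Type} [Field k] {n : ℕ}

/-- `N2` embeds into `N1` away from the vertex `x`. -/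
def Agree (x : Fin n) {Λ1 Λ2 : Fin n → Fin n → ℕ} (N1 : Rep k n Λ1) (N2 : Rep k n Λ2) : Prop :=
  ∃ E : ∀ z, (Fin (N2.d z) → k) →ₗ[k] (Fin (N1.d z) → k),
    (∀ z, z ≠ x → Function.Injective (E z)) ∧
    ∀ a b, a ≠ x → b ≠ x → ∀ (i : Fin (Λ2 a b)) (j : Fin (Λ1 a b)), i.val = j.val →
      ∀ v, E b (N2.f a b i v) = N1.f a b j (E a v)

theorem agree_step {x y : Fin n} (hxy : y ≠ x) {Λ1 Λ2 : Fin n → Fin n → ℕ}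
    (hΛ : ∀ a b, a ≠ x → b ≠ x → Λ1 a b = Λ2 a b)
    (hy1 : IsSink Λ1 y) (hy2 : IsSink Λ2 y) (hx1 : Λ1 x y = 0) (hx2 : Λ2 x y = 0)
    (N1 : Rep k n Λ1) (N2 : Rep k n Λ2) (h : Agree x N1 N2) :
    Agree x (reflPlus y Λ1 N1) (reflPlus y Λ2 N2) := by
  obtain ⟨E, hE, hc⟩ := h
  obtain ⟨E1, I1, ι1, a1, a2, a3, a4, a5, a6⟩ := reflPlus_spec y Λ1 N1
  obtain ⟨E2, I2, ι2, b1, b2, b3, b4, b5, b6⟩ := reflPlus_spec y Λ2 N2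
  have hay : ∀ a, Λ1 a y = Λ2 a y := by
    intro a
    by_cases ha : a = x
    · rw [ha, hx1, hx2]
    · exact hΛ a y ha hxy
  let T : ((p : Arin Λ2 y) → (Fin (N2.d p.1) → k)) →ₗ[k]
      ((p : Arin Λ1 y) → (Fin (N1.d p.1) → k)) :=
    LinearMap.pi fun p => E p.1 ∘ₗ
      LinearMap.proj (φ := fun p : Arin Λ2 y => Fin (N2.d p.1) → k)
        (⟨p.1, Fin.cast (hay p.1) p.2⟩ : Arin Λ2 y)
  have hT : ∀ w a (j : Fin (Λ1 a y)), T w ⟨a, j⟩ = E a (w ⟨a, Fin.cast (hay a) j⟩) :=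
    fun w a j => rfl
  have hne1 : ∀ a (j : Fin (Λ1 a y)), a ≠ x := by
    rintro a j rfl
    exact (Fin.cast hx1 j).elim0
  have hTin : ∀ w, inMap Λ1 N1 y (T w) = E y (inMap Λ2 N2 y w) := by
    intro w
    rw [inMap_apply, inMap_apply, map_sum, Fintype.sum_sigma, Fintype.sum_sigma]
    refine Finset.sum_congr rfl fun a _ => ?_
    refine Fintype.sum_equiv (finCongr (hay a)) _ _ fun j => ?_
    rw [hT]
    exact (hc a y (hne1 a j) hxy (Fin.cast (hay a) j) j rfl _).symm
  have hTinj : ∀ w, T w = 0 → w = 0 := by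
    intro w hw
    funext p
    obtain ⟨a, i⟩ := p
    have h1 := congrFun hw ⟨a, Fin.cast (hay a).symm i⟩
    rw [hT] at h1
    exact hE a (hne1 a (Fin.cast (hay a).symm i)) (h1.trans (map_zero _).symm)
  obtain ⟨r, hr⟩ := LinearMap.exists_leftInverse_of_injective ι1 (LinearMap.ker_eq_bot.2 a4)
  let θ := r ∘ₗ T ∘ₗ ι2
  have hθ : ∀ v, ι1 (θ v) = T (ι2 v) := by
    intro v
    have h0 : inMap Λ1 N1 y (T (ι2 v)) = 0 := by
      rw [hTin, (b5 _).2 ⟨v, rfl⟩, map_zero]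
    obtain ⟨u, hu⟩ := (a5 _).1 h0
    have : θ v = u := by
      simp only [θ, LinearMap.comp_apply]
      rw [← hu]
      exact LinearMap.congr_fun hr u
    rw [this, hu]
  refine ⟨Function.update (fun z => I1 z ∘ₗ E z ∘ₗ E2 z) y θ, ?_, ?_⟩
  · intro z hz
    by_cases hzy : z = y
    · subst hzy
      rw [Function.update_self, ← LinearMap.ker_eq_bot, LinearMap.ker_eq_bot']
      intro v hv
      have h1 := hθ v
      rw [hv, map_zero] at h1
      have h2 := hTinj _ h1.symm
      exact b4 (h2.trans (map_zero _).symm)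
    · rw [Function.update_of_ne hzy, ← LinearMap.ker_eq_bot, LinearMap.ker_eq_bot']
      intro v hv
      simp only [LinearMap.comp_apply] at hv
      have h1 : E z (E2 z v) = 0 := by rw [← a1 z hzy (E z (E2 z v)), hv, map_zero]
      have h2 : E2 z v = 0 := hE z hz (h1.trans (map_zero _).symm)
      rw [← b2 z hzy v, h2, map_zero]
  · intro a b ha hb i j hij v
    by_cases hby : b = y
    · subst hby; exact (noarrow_flip hy2 _ i).elim
    · rw [Function.update_of_ne hby]
      by_cases hay' : a = y
      · subst hay'
        rw [Function.update_self]
        simp only [LinearMap.comp_apply]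
        have hi := i.isLt
        have hj := j.isLt
        rw [b6 b hby i (Fin.cast (by simp [flipO]) i) rfl v]
        have h1 := a6 b hby j (Fin.cast (by simp [flipO]) j) rfl (θ v)
        rw [hθ, hT] at h1
        rw [← a2 b hby ((reflPlus a Λ1 N1).f a b j (θ v)), h1]
        have hq : (Fin.cast (by simp [flipO]) i : Fin (Λ2 b a)) =
            Fin.cast (hay b) (Fin.cast (by simp [flipO]) j) := Fin.ext hij
        rw [hq]
      · rw [Function.update_of_ne hay']
        simp only [LinearMap.comp_apply]
        rw [b3 a b hay' hby i (Fin.cast (by simp [flipO, hay', hby]) i) rfl,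
          hc a b ha hb _ (Fin.cast (by simp [flipO, hay', hby]) j) hij,
          ← a2 b hby ((reflPlus y Λ1 N1).f a b j _),
          a3 a b hay' hby j (Fin.cast (by simp [flipO, hay', hby]) j) rfl, a1 a hay']

theorem agree_list {x : Fin n} (L : List (Fin n)) : ∀ {Λ1 Λ2 : Fin n → Fin n → ℕ}
    (N1 : Rep k n Λ1) (N2 : Rep k n Λ2)
    (_ : ∀ y ∈ L, y ≠ x ∧ edges Λ1 x y = 0 ∧ edges Λ2 x y = 0)
    (_ : ∀ a b, a ≠ x → b ≠ x → Λ1 a b = Λ2 a b)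
    (_ : Admissible Λ1 L) (_ : Admissible Λ2 L) (_ : Agree x N1 N2),
    Agree x (FList L Λ1 N1) (FList L Λ2 N2) := by
  induction L with
  | nil => intro Λ1 Λ2 N1 N2 _ _ _ _ h; exact h
  | cons y L ih =>
    intro Λ1 Λ2 N1 N2 hL hΛ h1 h2 h
    have hy := hL y List.mem_cons_self
    have e1 := hy.2.1
    have e2 := hy.2.2
    unfold edges at e1 e2
    refine ih (reflPlus y Λ1 N1) (reflPlus y Λ2 N2) ?_ ?_ h1.2 h2.2
      (agree_step hy.1 hΛ h1.1 h2.1 (by omega) (by omega) N1 N2 h)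
    · intro z hz
      rw [edges_flip, edges_flip]
      exact hL z (List.mem_cons_of_mem _ hz)
    · intro a b ha hb
      simp only [flipO]
      rw [hΛ a b ha hb, hΛ b a hb ha]

theorem FList_d {x : Fin n} (L : List (Fin n)) : ∀ {Λ : Fin n → Fin n → ℕ} (N : Rep k n Λ),
    x ∉ L → (FList L Λ N).d x = N.d x := by
  induction L with
  | nil => intro Λ N _; rfl
  | cons y L ih =>
    intro Λ N hx
    have h1 : x ≠ y := fun h => hx (h ▸ List.mem_cons_self)
    have h2 : x ∉ L := fun h => hx (List.mem_cons_of_mem _ h)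
    exact (ih (reflPlus y Λ N) h2).trans (if_neg h1)

theorem ann_drop {x : Fin n} {Λ : Fin n → Fin n → ℕ} (L : List (Fin n)) (N : Rep k n Λ)
    (hL : ∀ y ∈ L, y ≠ x ∧ edges Λ x y = 0) (h1 : Admissible (flipO x Λ) L)
    (h2 : Admissible Λ L) (hd : N.d x = 0)
    (ha : Annihilates (flipO x Λ) L (reflPlus x Λ N)) : Annihilates Λ L N := by
  have hag : Agree x (reflPlus x Λ N) N := by
    obtain ⟨E, I, ι, a1, a2, a3, a4, a5, a6⟩ := reflPlus_spec x Λ N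
    refine ⟨I, ?_, ?_⟩
    · intro z hz
      exact Function.LeftInverse.injective (g := E z) (a1 z hz)
    · intro a b ha hb i j hij v
      rw [← a2 b hb ((reflPlus x Λ N).f a b j _), a3 a b ha hb j i hij.symm, a1 a ha]
  have := agree_list L (reflPlus x Λ N) N
    (fun y hy => ⟨(hL y hy).1, by rw [edges_flip]; exact (hL y hy).2, (hL y hy).2⟩)
    (fun a b ha hb => by simp [flipO, ha, hb]) h1 h2 hag
  obtain ⟨E, hE, -⟩ := this
  intro z
  by_cases hz : z = x
  · subst hz
    rw [FList_d L N (fun h => (hL z h).1 rfl), hd]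
  · have h3 := LinearMap.finrank_le_finrank_of_injective (hE z hz)
    rw [Module.finrank_fin_fun, Module.finrank_fin_fun] at h3
    have h4 : (FList L (flipO x Λ) (reflPlus x Λ N)).d z = 0 := ha z
    omega

theorem ann_append (S1 S2 : List (Fin n)) : ∀ (Λ : Fin n → Fin n → ℕ) (M : Rep k n Λ),
    Annihilates Λ (S1 ++ S2) M ↔ Annihilates (orientAfter Λ S1) S2 (FList S1 Λ M) := by
  induction S1 with
  | nil => intro Λ M; exact Iff.rfl
  | cons y S1 ih => intro Λ M; exact ih (flipO y Λ) (reflPlus y Λ M)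

end agree

section main

variable {k : Type} [Field k] {n : ℕ}

theorem exists_first (P : Fin n → Prop) (L : List (Fin n)) (h : ∃ y ∈ L, P y) :
    ∃ U y V, L = U ++ y :: V ∧ P y ∧ ∀ z ∈ U, ¬ P z := by
  induction L with
  | nil => simp at h
  | cons a L ih =>
    by_cases ha : P a
    · exact ⟨[], a, L, rfl, ha, by simp⟩
    · have h' : ∃ y ∈ L, P y := by
        obtain ⟨y, hy, hp⟩ := h
        rcases List.mem_cons.1 hy with rfl | hy
        · exact (ha hp).elim
        · exact ⟨y, hy, hp⟩
      obtain ⟨U, y, V, rfl, hy, hU⟩ := ih h'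
      refine ⟨a :: U, y, V, rfl, hy, ?_⟩
      intro z hz
      rcases List.mem_cons.1 hz with rfl | hz
      · exact ha
      · exact hU z hz

theorem main_pos (hn : 2 ≤ n) (Λ : Fin n → Fin n → ℕ)
    (hconn : ∀ a b : Fin n, Relation.ReflTransGen (fun u v => edges Λ u v ≠ 0) a b)
    (M : Rep k n Λ) (S : List (Fin n)) (hS : IsShortestAnn Λ M S) :
    ∀ (m : ℕ) (S1 : List (Fin n)) (x : Fin n) (S2 : List (Fin n)), S2.length = m →
      S = S1 ++ x :: S2 → AllPos (cartanOf Λ) (cartan_diag Λ) (Pi.single x 1) S1 := by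
  intro m
  induction m using Nat.strong_induction_on with
  | _ m ih =>
  intro S1 x S2 hm hSe
  obtain ⟨hadm, hann, hmin⟩ := hS
  have hadm' := hadm
  rw [hSe, admissible_append] at hadm'
  obtain ⟨hadm1, hxs, hadm2⟩ := hadm'
  by_cases hP : ∃ y ∈ S2, (y = x ∨ edges Λ x y ≠ 0)
  · obtain ⟨U, y, V, hS2, hy, hU⟩ := exists_first _ S2 hP
    have hU' : ∀ z ∈ U, z ≠ x ∧ edges Λ x z = 0 := by
      intro z hz
      have := hU z hz
      push Not at this
      exact this
    by_cases hyx : y = x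
    · exfalso
      subst hyx
      rw [hS2, admissible_append] at hadm2
      obtain ⟨-, hs, -⟩ := hadm2
      rw [sink_after U (by
        intro z hz
        rw [edges_flip, edges_orientAfter]
        exact hU' z hz)] at hs
      have he : ∀ z, edges Λ y z = 0 := by
        intro z
        rw [← edges_orientAfter S1 Λ]
        have h1 := hxs z
        have h2 := hs z
        simp [flipO] at h2
        simp [edges, h1, h2]
      have : ∃ z : Fin n, z ≠ y := by
        haveI : Nontrivial (Fin n) := Fin.nontrivial_iff_two_le.2 hn
        exact exists_ne y
      obtain ⟨z, hz⟩ := this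
      rcases Relation.ReflTransGen.cases_head (hconn y z) with h | ⟨c, hc, -⟩
      · exact hz h.symm
      · exact hc (he c)
    · have hye : edges Λ x y ≠ 0 := hy.resolve_left hyx
      have hpos := ih V.length (by rw [← hm, hS2]; simp; omega) (S1 ++ x :: U) y V rfl
        (by rw [hSe, hS2]; simp)
      set v := prodW (cartanOf Λ) (cartan_diag Λ) U (Pi.single y 1) with hv
      have hv0 : 0 ≤ v := hpos (S1 ++ [x]) U (by simp)
      have hvx : v x = 0 := by
        rw [hv, prodW_coord _ _ _ _ _ (fun h => (hU' x h).1 rfl)]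
        exact Pi.single_eq_of_ne (Ne.symm hyx) _
      have hvy : v y = 1 := by
        rw [hv, prodW_coord _ _ _ _ _ (fun h => hye (hU' y h).2)]
        exact Pi.single_eq_same _ _
      have hbx : 0 < prodW (cartanOf Λ) (cartan_diag Λ) (x :: U) (Pi.single y 1) x := by
        rw [prodW_cons, ← hv, sigmaE_apply]
        simp only [Pi.sub_apply, Pi.smul_apply, Pi.single_eq_same, smul_eq_mul, mul_one, hvx]
        have hneg : ∑ l, cartanOf Λ x l * v l < 0 := by
          have hle : ∀ l, cartanOf Λ x l * v l ≤ 0 := by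
            intro l
            by_cases hl : x = l
            · subst hl; simp [hvx]
            · exact mul_nonpos_of_nonpos_of_nonneg (cartan_neg Λ x l hl) (hv0 l)
          refine Finset.sum_neg' (fun l _ => hle l) ⟨y, Finset.mem_univ _, ?_⟩
          rw [hvy, mul_one]
          simp only [cartanOf, if_neg (Ne.symm hyx)]
          have := Nat.pos_of_ne_zero hye
          omega
        omega
      exact (lemmaC _ _ x _ hbx S1 Λ rfl hadm1 hxs (AllPos.append hpos)).1
  · push Not at hP
    have hP1 : ∀ y ∈ S2, y ≠ x ∧ edges (orientAfter Λ S1) x y = 0 := by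
      intro y hy
      rw [edges_orientAfter]
      exact hP y hy
    refine (lemmaR (k := k) _ _ x S1 Λ M rfl hadm1 hxs ?_).1
    intro hd
    have hadm3 := (admissible_flip S2 hP1).1 hadm2
    have hadmS : Admissible Λ (S1 ++ S2) := (admissible_append _ _ _).2 ⟨hadm1, hadm3⟩
    have hannS : Annihilates Λ (S1 ++ S2) M := by
      rw [ann_append]
      rw [hSe, ann_append] at hann
      exact ann_drop S2 _ hP1 hadm2 hadm3 hd hann
    have hsim := hmin _ hadmS hannS ⟨[x], ⟨by
      rw [orientAfter_append, sink_after S2 hP1]; exact hxs, trivial⟩, by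
      rw [hSe]; exact sim_move _ x S2 S1 (fun y hy => (hP y hy).2)⟩
    have := sim_length hsim
    rw [hSe] at this
    simp at this

end main

theorem word_of_shortest_sequence_is_reduced
    (n : ℕ) (hn : 2 ≤ n) (Λ : Fin n → Fin n → ℕ)
    (hloop : ∀ a, Λ a a = 0)
    (hconn : ∀ a b : Fin n, Relation.ReflTransGen (fun u v => edges Λ u v ≠ 0) a b)
    (hacyc : ∀ a : Fin n, ¬ Relation.TransGen (fun u v => Λ u v ≠ 0) a a)
    (k : Type) [Field k]
    (M : Rep k n Λ) (hM : Preprojective Λ M)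
    (S : List (Fin n)) (hS : IsShortestAnn Λ M S) :
    IsReducedSeq Λ S := by
  change wordLen (cartanOf Λ) (cartan_diag Λ)
    (prodW (cartanOf Λ) (cartan_diag Λ) S.reverse) = S.length
  rw [wordLen_reverse]
  refine len_of_pos _ _ (cartan_sym Λ) (cartan_neg Λ) S ?_
  intro S1 x S2 hSe
  exact main_pos hn Λ hconn M S hS _ S1 x S2 rfl hSe [] S1 rfl

end KP
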